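/- arXiv:1811.09697 — 3 statements merged into one kernel-verified Lean document; each statement's English description precedes it below -/
import Mathlib

section
/- Let p ≥ 2 be an integer and c = (c₁, c₂) ∈ ℂ × ℂ with componentwise ring operations, and f_c(w) = w^p + c. Then the bicomplex filled-in Julia set K_{2,c}^p = {w ∈ ℂ × ℂ : (f_c^m(w))_{m≥1} is bounded} is a connected set if and only if 0 = (0,0) ∈ K_{2,c}^p. -/
open Set Filter Topology Metric Bornology

section PreimageConnected

variable {X Y : Type*} [TopologicalSpace X] [TopologicalSpace Y]

/-- An open and closed map that is injective over one point of a preconnected set `s` has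
preconnected preimage `f ⁻¹' s`. -/
theorem IsPreconnected.preimage_of_isOpenMap_of_isClosedMap {f : X → Y} (ho : IsOpenMap f)
    (hc : IsClosedMap f) {s : Set Y} (hs : IsPreconnected s) {y : Y} (hy : y ∈ s)
    (hfib : (f ⁻¹' {y}).Subsingleton) : IsPreconnected (f ⁻¹' s) := by
  have : PreconnectedSpace s := isPreconnected_iff_preconnectedSpace.1 hs
  rw [isPreconnected_iff_preconnectedSpace, preconnectedSpace_iff_clopen]
  have key : ∀ V : Set (f ⁻¹' s), IsClopen V → V.Nonempty → ∃ x ∈ V, f x = y := by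
    intro V hV hne
    have hcl : IsClopen (s.restrictPreimage f '' V) :=
      ⟨hc.restrictPreimage s _ hV.isClosed, ho.restrictPreimage s _ hV.isOpen⟩
    have huniv := hcl.eq_univ (hne.image _)
    obtain ⟨x, hx, hxy⟩ : (⟨y, hy⟩ : s) ∈ s.restrictPreimage f '' V := huniv ▸ mem_univ _
    exact ⟨x, hx, congrArg Subtype.val hxy⟩
  intro U hU
  by_contra! h
  obtain ⟨a, ha, hay⟩ := key U hU h.1
  obtain ⟨b, hb, hby⟩ := key Uᶜ hU.compl (nonempty_compl.2 h.2)
  exact hb (Subtype.ext (hfib hay hby) ▸ ha)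

/-- A decreasing intersection of compact preconnected sets is preconnected. -/
theorem IsPreconnected.iInter_of_antitone [T2Space X] [NormalSpace X] {D : ℕ → Set X}
    (hD : Antitone D) (hcomp : ∀ n, IsCompact (D n)) (hconn : ∀ n, IsPreconnected (D n)) :
    IsPreconnected (⋂ n, D n) := by
  have hclosed : IsClosed (⋂ n, D n) := isClosed_iInter fun n => (hcomp n).isClosed
  rw [isPreconnected_iff_subset_of_fully_disjoint_closed hclosed]
  intro u v hu hv huv hdisj
  obtain ⟨U, V, hU, hV, huU, hvV, hUV⟩ := normal_separation hu hv hdisj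
  obtain ⟨n, hn⟩ := exists_subset_nhds_of_isCompact hD.directed_ge hcomp (U := U ∪ V)
    fun x hx => (hU.union hV).mem_nhds (union_subset_union huU hvV (huv hx))
  refine (isPreconnected_iff_subset_of_disjoint.1 (hconn n) U V hU hV hn
    (by rw [hUV.inter_eq, inter_empty])).imp (fun h x hx => ?_) fun h x hx => ?_
  · exact (huv hx).resolve_right fun hxv =>
      disjoint_left.1 hUV (h (mem_iInter.1 hx n)) (hvV hxv)
  · exact (huv hx).resolve_left fun hxu =>
      disjoint_left.1 hUV (huU hxu) (h (mem_iInter.1 hx n))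

end PreimageConnected

section ContinuousRoots

variable {K : Set ℂ} {p : ℕ}

theorem exists_continuousOn_pow_eq_of_mem_slitPlane (hp : p ≠ 0) {u : ℂ → ℂ}
    (hu : ContinuousOn u K) (hs : ∀ z ∈ K, u z ∈ Complex.slitPlane) :
    ∃ h : ℂ → ℂ, ContinuousOn h K ∧ ∀ z ∈ K, h z ^ p = u z := by
  refine ⟨fun z => Complex.exp (Complex.log (u z) / p),
    ((hu.clog hs).div_const _).cexp, fun z hz => ?_⟩
  rw [← Complex.exp_nat_mul, mul_div_cancel₀ _ (Nat.cast_ne_zero.2 hp),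
    Complex.exp_log (Complex.slitPlane_ne_zero (hs z hz))]

/-- `K` carries a continuous branch of `(z - a) ^ (1 / p)`. -/
def HasContinuousRoot (K : Set ℂ) (p : ℕ) (a : ℂ) : Prop :=
  ∃ g : ℂ → ℂ, ContinuousOn g K ∧ ∀ z ∈ K, g z ^ p = z - a

theorem hasContinuousRoot_congr (hp : p ≠ 0) {a b : ℂ} (hab : ∀ z ∈ K, ‖b - a‖ < ‖z - a‖) :
    HasContinuousRoot K p a ↔ HasContinuousRoot K p b := by
  have hne : ∀ z ∈ K, z - a ≠ 0 := fun z hz =>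
    norm_pos_iff.1 ((norm_nonneg _).trans_lt (hab z hz))
  have hslit : ∀ z ∈ K, 1 + (a - b) / (z - a) ∈ Complex.slitPlane := fun z hz => by
    refine Complex.mem_slitPlane_of_norm_lt_one ?_
    rw [norm_div, norm_sub_rev a b, div_lt_one (norm_pos_iff.2 (hne z hz))]
    exact hab z hz
  obtain ⟨h, hc, hh⟩ := exists_continuousOn_pow_eq_of_mem_slitPlane hp (K := K)
    (u := fun z => 1 + (a - b) / (z - a))
    (continuousOn_const.add (continuousOn_const.div (by fun_prop) hne)) hslit
  have hprod : ∀ z ∈ K, (z - a) * h z ^ p = z - b := fun z hz => by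
    rw [hh z hz]
    field_simp [hne z hz]
    ring
  have hh0 : ∀ z ∈ K, h z ^ p ≠ 0 := fun z hz => by
    rw [hh z hz]
    exact Complex.slitPlane_ne_zero (hslit z hz)
  constructor
  · rintro ⟨g, hg, hgp⟩
    exact ⟨fun z => g z * h z, hg.mul hc, fun z hz => by
      rw [mul_pow, hgp z hz, hprod z hz]⟩
  · rintro ⟨g, hg, hgp⟩
    refine ⟨fun z => g z / h z, hg.div hc fun z hz h0 => hh0 z hz (by simp [h0, hp]),
      fun z hz => ?_⟩
    rw [div_pow, hgp z hz, ← hprod z hz, mul_div_cancel_right₀ _ (hh0 z hz)]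

theorem hasContinuousRoot_of_norm_lt (hp : p ≠ 0) {a : ℂ} (ha : ∀ z ∈ K, ‖z‖ < ‖a‖) :
    HasContinuousRoot K p a := by
  rcases eq_or_ne a 0 with rfl | h0
  · exact ⟨0, continuousOn_const, fun z hz => absurd (ha z hz) (by simp)⟩
  obtain ⟨h, hc, hh⟩ := exists_continuousOn_pow_eq_of_mem_slitPlane hp (K := K)
    (u := fun z => 1 + -(z / a)) (by fun_prop) fun z hz => by
      refine Complex.mem_slitPlane_of_norm_lt_one ?_
      rw [norm_neg, norm_div, div_lt_one (norm_pos_iff.2 h0)]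
      exact ha z hz
  obtain ⟨r, hr⟩ := IsAlgClosed.exists_pow_nat_eq (-a) (Nat.pos_of_ne_zero hp)
  refine ⟨fun z => r * h z, continuousOn_const.mul hc, fun z hz => ?_⟩
  rw [mul_pow, hr, hh z hz]
  field_simp
  ring

/-- If `a` lies outside the polynomially convex hull of `K`, as witnessed by an entire
function `F`, then `K` carries a continuous branch of `(z - a) ^ (1 / p)`. -/
theorem hasContinuousRoot_of_norm_le_of_lt (hp : p ≠ 0) (hK : IsCompact K) {F : ℂ → ℂ}
    (hF : Differentiable ℂ F) {C : ℝ} (hC : ∀ z ∈ K, ‖F z‖ ≤ C) {a : ℂ} (ha : C < ‖F a‖) :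
    HasContinuousRoot K p a := by
  by_contra hroot
  set W : Set ℂ := {b | b ∉ K ∧ ¬ HasContinuousRoot K p b}
  have hloc : ∀ x ∉ K, ∃ ε > 0, ∀ b ∈ ball x ε,
      b ∉ K ∧ (HasContinuousRoot K p x ↔ HasContinuousRoot K p b) := by
    intro x hx
    obtain ⟨ε, hε, hball⟩ := Metric.isOpen_iff.1 hK.isClosed.isOpen_compl x hx
    refine ⟨ε, hε, fun b hb => ⟨hball hb, hasContinuousRoot_congr hp fun z hz => ?_⟩⟩
    rw [← dist_eq_norm, ← dist_eq_norm]
    exact (mem_ball.1 hb).trans_le (not_lt.1 fun h => hball (mem_ball.2 h) hz)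
  have hopen : IsOpen W := Metric.isOpen_iff.2 fun x hx => by
    obtain ⟨ε, hε, h⟩ := hloc x hx.1
    exact ⟨ε, hε, fun b hb => ⟨(h b hb).1, mt (h b hb).2.2 hx.2⟩⟩
  have hfront : frontier W ⊆ K := by
    intro x hx
    by_contra hxK
    obtain ⟨ε, hε, h⟩ := hloc x hxK
    obtain ⟨b, hbW, hb⟩ := Metric.mem_closure_iff.1 hx.1 ε hε
    have hxW : x ∈ W := ⟨hxK, mt (h b (by rwa [mem_ball'])).2.1 hbW.2⟩
    exact hx.2 (hopen.interior_eq.symm ▸ hxW)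
  have hbdd : IsBounded W := by
    obtain ⟨R, hR⟩ := hK.isBounded.exists_norm_le
    refine isBounded_iff_forall_norm_le.2 ⟨R, fun b hb => not_lt.1 fun hlt => hb.2 ?_⟩
    exact hasContinuousRoot_of_norm_lt hp fun z hz => (hR z hz).trans_lt hlt
  have haW : a ∈ W := ⟨fun h => (hC a h).not_gt ha, hroot⟩
  exact ha.not_ge (Complex.norm_le_of_forall_mem_frontier_norm_le hbdd hF.diffContOnCl
    (fun z hz => hC z (hfront hz)) (subset_closure haW))

end ContinuousRoots

section FilledJulia

variable {p : ℕ} {c z : ℂ}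

/-- The filled-in Julia set of `z ↦ z ^ p + c`. -/
def filledJulia (p : ℕ) (c : ℂ) : Set ℂ :=
  {z | IsBounded (range fun m : ℕ => (fun v : ℂ => v ^ p + c)^[m] z)}

theorem two_mul_norm_le_norm_pow_add (hp : 2 ≤ p) (hz : 2 + ‖c‖ ≤ ‖z‖) :
    2 * ‖z‖ ≤ ‖z ^ p + c‖ := by
  have hc := norm_nonneg c
  have h1 : ‖z‖ ^ 2 ≤ ‖z‖ ^ p := pow_le_pow_right₀ (by linarith) hp
  have h2 : ‖z ^ p‖ - ‖c‖ ≤ ‖z ^ p + c‖ := by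
    simpa using norm_sub_norm_le (z ^ p) (-c)
  rw [norm_pow] at h2
  nlinarith

theorem norm_le_of_norm_pow_add_le (hp : 2 ≤ p) (h : ‖z ^ p + c‖ ≤ 2 + ‖c‖) :
    ‖z‖ ≤ 2 + ‖c‖ := by
  by_contra! hz
  have := two_mul_norm_le_norm_pow_add hp hz.le
  linarith [norm_nonneg c, norm_nonneg z]

theorem mem_filledJulia_iff (hp : 2 ≤ p) :
    z ∈ filledJulia p c ↔ ∀ m, ‖(fun v : ℂ => v ^ p + c)^[m] z‖ ≤ 2 + ‖c‖ := by
  refine ⟨fun h m => ?_, fun h => isBounded_iff_forall_norm_le.2 ⟨_, forall_mem_range.2 h⟩⟩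
  by_contra! hm
  set w := (fun v : ℂ => v ^ p + c)^[m] z
  have hgrow : ∀ n : ℕ, 2 ^ n * ‖w‖ ≤ ‖(fun v : ℂ => v ^ p + c)^[n] w‖ := by
    intro n
    induction n with
    | zero => simp
    | succ n ih =>
      have hle : ‖w‖ ≤ 2 ^ n * ‖w‖ :=
        le_mul_of_one_le_left (norm_nonneg _) (one_le_pow₀ one_le_two)
      rw [Function.iterate_succ_apply']
      have := two_mul_norm_le_norm_pow_add hp (hm.le.trans (hle.trans ih))
      rw [pow_succ]
      linarith
  obtain ⟨C, hC⟩ := isBounded_iff_forall_norm_le.1 (show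
    IsBounded (range fun m : ℕ => (fun v : ℂ => v ^ p + c)^[m] z) from h)
  obtain ⟨n, hn⟩ := pow_unbounded_of_one_lt C (one_lt_two (α := ℝ))
  have hbound := hC _ (mem_range_self (n + m))
  simp only [Function.iterate_add_apply] at hbound
  have hw1 : 1 ≤ ‖w‖ := by linarith [norm_nonneg c]
  have := le_mul_of_one_le_right (pow_nonneg (zero_le_two (α := ℝ)) n) hw1
  linarith [hgrow n]

theorem pow_add_mem_filledJulia_iff (hp : 2 ≤ p) :
    z ^ p + c ∈ filledJulia p c ↔ z ∈ filledJulia p c := by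
  rw [mem_filledJulia_iff hp, mem_filledJulia_iff hp]
  refine ⟨fun h m => ?_, fun h m => h (m + 1)⟩
  cases m with
  | zero => exact norm_le_of_norm_pow_add_le hp (h 0)
  | succ m => exact h m

theorem filledJulia_nonempty (hp : 2 ≤ p) : (filledJulia p c).Nonempty := by
  obtain ⟨z, hz⟩ := IsAlgClosed.exists_root
    (Polynomial.X ^ p + (Polynomial.C c - Polynomial.X) : Polynomial ℂ) (by
      rw [Polynomial.degree_add_eq_left_of_degree_lt]
      · simp; lia
      · refine (Polynomial.degree_sub_le _ _).trans_lt ?_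
        rw [Polynomial.degree_X_pow, max_lt_iff, Polynomial.degree_X]
        exact ⟨Polynomial.degree_C_le.trans_lt (by exact_mod_cast (by lia : 0 < p)),
          by exact_mod_cast (by lia : 1 < p)⟩)
  have hfix : z ^ p + c = z := by
    simp [Polynomial.IsRoot] at hz
    linear_combination hz
  refine ⟨z, (mem_filledJulia_iff hp).2 fun m => ?_⟩
  rw [Function.iterate_fixed (f := fun v : ℂ => v ^ p + c) hfix]
  refine norm_le_of_norm_pow_add_le hp (not_lt.1 fun h => ?_)
  rw [hfix] at h
  have := two_mul_norm_le_norm_pow_add hp h.le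
  rw [hfix] at this
  linarith [norm_nonneg c]

theorem continuous_iterate_pow_add (n : ℕ) :
    Continuous (fun v : ℂ => v ^ p + c)^[n] :=
  Continuous.iterate (by fun_prop) n

theorem isCompact_setOf_norm_iterate_le (hp : 2 ≤ p) (n : ℕ) :
    IsCompact {z : ℂ | ‖(fun v : ℂ => v ^ p + c)^[n] z‖ ≤ 2 + ‖c‖} := by
  refine (isCompact_closedBall (0 : ℂ) (2 + ‖c‖)).of_isClosed_subset
    (isClosed_le (continuous_iterate_pow_add n).norm continuous_const) fun z hz => ?_
  rw [mem_closedBall_zero_iff]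
  induction n generalizing z with
  | zero => exact hz
  | succ n ih => exact norm_le_of_norm_pow_add_le hp (ih _ hz)

theorem filledJulia_eq_iInter (hp : 2 ≤ p) :
    filledJulia p c = ⋂ n : ℕ, {z : ℂ | ‖(fun v : ℂ => v ^ p + c)^[n] z‖ ≤ 2 + ‖c‖} := by
  ext z
  simp [mem_filledJulia_iff hp]

theorem isCompact_filledJulia (hp : 2 ≤ p) : IsCompact (filledJulia p c) := by
  rw [filledJulia_eq_iInter hp]
  exact (isCompact_setOf_norm_iterate_le hp 0).of_isClosed_subset
    (isClosed_iInter fun n => (isCompact_setOf_norm_iterate_le hp n).isClosed)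
    (iInter_subset _ 0)

theorem isPreconnected_preimage_pow_add (hp : p ≠ 0) {s : Set ℂ} (hs : IsPreconnected s)
    (hc : c ∈ s) : IsPreconnected ((fun v : ℂ => v ^ p + c) ⁻¹' s) := by
  have : NeZero p := ⟨hp⟩
  have ho : IsOpenMap fun v : ℂ => v ^ p + c :=
    (Homeomorph.addRight c).isOpenMap.comp (Complex.isOpenQuotientMap_pow p).isOpenMap
  have hcl : IsClosedMap fun v : ℂ => v ^ p + c :=
    (Homeomorph.addRight c).isClosedMap.comp (isClosedMap_pow ℂ p)
  refine hs.preimage_of_isOpenMap_of_isClosedMap ho hcl hc fun x hx y hy => ?_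
  simp [hp] at hx hy
  rw [hx, hy]

theorem isPreconnected_filledJulia (hp : 2 ≤ p) (h0 : 0 ∈ filledJulia p c) :
    IsPreconnected (filledJulia p c) := by
  have hc : c ∈ filledJulia p c := by
    simpa [show p ≠ 0 by lia] using (pow_add_mem_filledJulia_iff hp).2 h0
  rw [mem_filledJulia_iff hp] at hc
  rw [filledJulia_eq_iInter hp]
  refine IsPreconnected.iInter_of_antitone (antitone_nat_of_succ_le fun n z hz => ?_)
    (isCompact_setOf_norm_iterate_le hp) fun n => ?_
  · rw [mem_ofPred_eq, Function.iterate_succ_apply'] at hz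
    exact norm_le_of_norm_pow_add_le hp hz
  · induction n with
    | zero =>
      have : {z : ℂ | ‖(fun v : ℂ => v ^ p + c)^[0] z‖ ≤ 2 + ‖c‖} =
          closedBall 0 (2 + ‖c‖) := by
        ext z
        simp
      rw [this]
      exact (convex_closedBall _ _).isPreconnected
    | succ n ih => exact isPreconnected_preimage_pow_add (by lia) ih (hc n)

theorem zero_mem_filledJulia_of_isPreconnected (hp : 2 ≤ p)
    (hK : IsPreconnected (filledJulia p c)) : 0 ∈ filledJulia p c := by
  have hp0 : p ≠ 0 := by lia
  rw [← pow_add_mem_filledJulia_iff hp, zero_pow hp0, zero_add]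
  by_contra hc
  obtain ⟨n, hn⟩ : ∃ n, 2 + ‖c‖ < ‖(fun v : ℂ => v ^ p + c)^[n] c‖ := by
    simpa [mem_filledJulia_iff hp] using hc
  obtain ⟨g, hg, hgp⟩ := hasContinuousRoot_of_norm_le_of_lt hp0 (isCompact_filledJulia hp)
    (Differentiable.iterate (by fun_prop) n) (fun z hz => (mem_filledJulia_iff hp).1 hz n) hn
  have hmaps : MapsTo (fun v : ℂ => v ^ p + c) (filledJulia p c) (filledJulia p c) :=
    fun z hz => (pow_add_mem_filledJulia_iff hp).2 hz
  have hg0 : ∀ z ∈ filledJulia p c, g z ≠ 0 := fun z hz h => by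
    have := hgp z hz
    rw [h, zero_pow hp0, eq_comm, sub_eq_zero] at this
    exact hc (this ▸ hz)
  obtain ⟨z, hz⟩ := filledJulia_nonempty (c := c) hp
  obtain ⟨ζ, hζ⟩ : ∃ ζ : ℂ, IsPrimitiveRoot ζ p := ⟨_, Complex.isPrimitiveRoot_exp p hp0⟩
  have hlift : ∀ ω : ℂ, ω ^ p = 1 → (g z * ω) ^ p + c = z := fun ω hω => by
    rw [mul_pow, hω, hgp z hz]
    ring
  have hmem : ∀ ω : ℂ, ω ^ p = 1 → g z * ω ∈ filledJulia p c := fun ω hω => by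
    rwa [← pow_add_mem_filledJulia_iff hp, hlift ω hω]
  have hfin : {ω : ℂ | ω ^ p = 1}.Finite := by
    refine (Polynomial.nthRoots p (1 : ℂ)).toFinset.finite_toSet.subset fun ω hω => ?_
    simpa [Polynomial.mem_nthRoots (Nat.pos_of_ne_zero hp0)] using hω
  have hcont : ContinuousOn (fun w => w / g (w ^ p + c)) (filledJulia p c) :=
    continuousOn_id.div (hg.comp (by fun_prop) hmaps) fun w hw => hg0 _ (hmaps hw)
  have hroots : MapsTo (fun w => w / g (w ^ p + c)) (filledJulia p c) {ω : ℂ | ω ^ p = 1} := by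
    intro w hw
    have := hgp _ (hmaps hw)
    rw [mem_ofPred_eq, div_pow, this, add_sub_cancel_right]
    refine div_self fun h => pow_ne_zero p (hg0 _ (hmaps hw)) ?_
    rw [this, add_sub_cancel_right, h]
  have hconst := hK.constant_of_mapsTo hfin.isDiscrete hcont hroots
    (hmem 1 (one_pow p)) (hmem ζ hζ.pow_eq_one)
  simp only [hlift 1 (one_pow p), hlift ζ hζ.pow_eq_one,
    mul_div_cancel_left₀ _ (hg0 z hz)] at hconst
  exact hζ.ne_one hp hconst.symm

theorem isConnected_filledJulia_iff (hp : 2 ≤ p) :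
    IsConnected (filledJulia p c) ↔ 0 ∈ filledJulia p c :=
  ⟨fun h => zero_mem_filledJulia_of_isPreconnected hp h.isPreconnected,
    fun h => ⟨filledJulia_nonempty hp, isPreconnected_filledJulia hp h⟩⟩

end FilledJulia

theorem isConnected_prod_iff {X Y : Type*} [TopologicalSpace X] [TopologicalSpace Y]
    {s : Set X} {t : Set Y} : IsConnected (s ×ˢ t) ↔ IsConnected s ∧ IsConnected t := by
  refine ⟨fun h => ⟨?_, ?_⟩, fun h => h.1.prod h.2⟩
  · simpa only [fst_image_prod s h.nonempty.snd] using h.image _ continuous_fst.continuousOn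
  · simpa only [snd_image_prod h.nonempty.fst t] using h.image _ continuous_snd.continuousOn

theorem setOf_isBounded_iterate_pow_add_eq_prod (p : ℕ) (c : ℂ × ℂ) :
    {w : ℂ × ℂ | IsBounded (range fun m : ℕ => (fun v : ℂ × ℂ => v ^ p + c)^[m] w)} =
      filledJulia p c.1 ×ˢ filledJulia p c.2 := by
  have hiter : ∀ (w : ℂ × ℂ) (m : ℕ), (fun v : ℂ × ℂ => v ^ p + c)^[m] w =
      ((fun v : ℂ => v ^ p + c.1)^[m] w.1, (fun v : ℂ => v ^ p + c.2)^[m] w.2) :=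
    fun w m => congrFun (Prod.map_iterate (fun v : ℂ => v ^ p + c.1) (fun v => v ^ p + c.2) m) w
  ext w
  rw [mem_ofPred_eq, ← isBounded_image_fst_and_snd, ← range_comp, ← range_comp]
  simp only [Function.comp_def, hiter]
  rfl

/-- The bicomplex filled-in Julia set of `f_c(w) = w^p + c` is connected
if and only if `0` belongs to it. -/
theorem bicomplex_filledJulia_isConnected_iff (p : ℕ) (hp : 2 ≤ p) (c : ℂ × ℂ) :
    IsConnected {w : ℂ × ℂ | Bornology.IsBounded
        (Set.range fun m : ℕ => (fun v : ℂ × ℂ => v ^ p + c)^[m] w)} ↔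
      (0 : ℂ × ℂ) ∈ {w : ℂ × ℂ | Bornology.IsBounded
        (Set.range fun m : ℕ => (fun v : ℂ × ℂ => v ^ p + c)^[m] w)} := by
  rw [setOf_isBounded_iterate_pow_add_eq_prod, isConnected_prod_iff,
    isConnected_filledJulia_iff hp, isConnected_filledJulia_iff hp]
  rfl
end

section
/- Let p ≥ 2 be an integer. The bicomplex Multibrot set M_2^p = {c ∈ ℂ × ℂ : (f_c^m(0))_{m≥1} is bounded}, where ℂ × ℂ carries componentwise ring operations and f_c(w) = w^p + c, is a connected subset of ℂ × ℂ. -/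
open Filter Topology Set

/-- The unicritical polynomial map `z ↦ z ^ p + c`. -/
def unicritical (p : ℕ) (c z : ℂ) : ℂ := z ^ p + c

/-- The `k`-th iterate of `z ↦ z ^ p + c` at the critical value `c`. -/
def critValueOrbit (p k : ℕ) (c : ℂ) : ℂ := (unicritical p c)^[k] c

lemma critValueOrbit_zero (p : ℕ) (c : ℂ) : critValueOrbit p 0 c = c := rfl

lemma critValueOrbit_succ (p k : ℕ) (c : ℂ) :
    critValueOrbit p (k + 1) c = critValueOrbit p k c ^ p + c := by
  simp only [critValueOrbit, Function.iterate_succ_apply', unicritical]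

lemma continuous_critValueOrbit (p k : ℕ) : Continuous (critValueOrbit p k) := by
  induction k with
  | zero => exact continuous_id
  | succ k ih =>
    rw [show critValueOrbit p (k + 1) = fun c => critValueOrbit p k c ^ p + c from
      funext (critValueOrbit_succ p k)]
    fun_prop

lemma exists_polynomial_critValueOrbit {p : ℕ} (hp : 1 ≤ p) (k : ℕ) :
    ∃ P : Polynomial ℂ, P.natDegree ≤ p ^ k ∧ ∀ c, P.eval c = critValueOrbit p k c := by
  induction k with
  | zero => exact ⟨Polynomial.X, by simp, by simp [critValueOrbit_zero]⟩
  | succ k ih =>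
    obtain ⟨P, hP, hc⟩ := ih
    refine ⟨P ^ p + Polynomial.X, ?_, fun c => by simp [critValueOrbit_succ, hc]⟩
    refine (Polynomial.natDegree_add_le _ _).trans (max_le ?_ ?_)
    · calc (P ^ p).natDegree ≤ p * P.natDegree := Polynomial.natDegree_pow_le
        _ ≤ p ^ (k + 1) := by rw [pow_succ']; gcongr
    · simpa using Nat.one_le_pow _ _ hp

lemma norm_mul_sub_one_le_norm_pow_add {p : ℕ} (hp : 2 ≤ p) {c z : ℂ} (hz : 1 ≤ ‖z‖)
    (hcz : ‖c‖ ≤ ‖z‖) : ‖z‖ * (‖z‖ - 1) ≤ ‖z ^ p + c‖ := by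
  have h₁ : ‖z‖ ^ 2 ≤ ‖z ^ p‖ := by
    rw [norm_pow]; exact pow_le_pow_right₀ hz hp
  have h₂ : ‖z ^ p‖ - ‖c‖ ≤ ‖z ^ p + c‖ := by
    simpa using norm_sub_norm_le (z ^ p) (-c)
  nlinarith

lemma norm_le_norm_critValueOrbit {p : ℕ} (hp : 2 ≤ p) {c : ℂ} (hc : 2 ≤ ‖c‖) (k : ℕ) :
    ‖c‖ ≤ ‖critValueOrbit p k c‖ := by
  induction k with
  | zero => rfl
  | succ k ih =>
    have := norm_mul_sub_one_le_norm_pow_add hp (by linarith) ih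
    rw [critValueOrbit_succ]
    nlinarith

lemma norm_le_norm_critValueOrbit_of_two_lt {p : ℕ} (hp : 2 ≤ p) {c : ℂ} {k : ℕ}
    (hk : 2 < ‖critValueOrbit p k c‖) : ‖c‖ ≤ ‖critValueOrbit p k c‖ := by
  rcases le_total 2 ‖c‖ with hc | hc
  · exact norm_le_norm_critValueOrbit hp hc k
  · linarith

lemma norm_critValueOrbit_mul_le {p : ℕ} (hp : 2 ≤ p) {c : ℂ} {k : ℕ}
    (hk : 2 < ‖critValueOrbit p k c‖) :
    ‖critValueOrbit p k c‖ * (‖critValueOrbit p k c‖ - 1) ≤ ‖critValueOrbit p (k + 1) c‖ := by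
  rw [critValueOrbit_succ]
  exact norm_mul_sub_one_le_norm_pow_add hp (by linarith)
    (norm_le_norm_critValueOrbit_of_two_lt hp hk)

lemma norm_critValueOrbit_lt_succ {p : ℕ} (hp : 2 ≤ p) {c : ℂ} {k : ℕ}
    (hk : 2 < ‖critValueOrbit p k c‖) :
    ‖critValueOrbit p k c‖ < ‖critValueOrbit p (k + 1) c‖ := by
  nlinarith [norm_critValueOrbit_mul_le hp hk]

lemma norm_critValueOrbit_lt_of_lt {p : ℕ} (hp : 2 ≤ p) {c : ℂ} {j k : ℕ} (hjk : j < k)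
    (hk : 2 < ‖critValueOrbit p k c‖) : ‖critValueOrbit p j c‖ < ‖critValueOrbit p k c‖ := by
  by_cases hj : ‖critValueOrbit p j c‖ ≤ 2
  · linarith
  push Not at hj
  clear hk
  induction k, hjk using Nat.le_induction with
  | base => exact norm_critValueOrbit_lt_succ hp hj
  | succ k hjk ih => exact ih.trans (norm_critValueOrbit_lt_succ hp (hj.trans ih))

lemma geometric_growth_critValueOrbit {p : ℕ} (hp : 2 ≤ p) {c : ℂ} {k : ℕ}
    (hk : 2 < ‖critValueOrbit p k c‖) (n : ℕ) :
    (‖critValueOrbit p k c‖ - 1) ^ n ≤ ‖critValueOrbit p (k + n) c‖ := by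
  have hmono : ∀ n, ‖critValueOrbit p k c‖ ≤ ‖critValueOrbit p (k + n) c‖ := by
    intro n
    induction n with
    | zero => rfl
    | succ n ih => exact ih.trans (norm_critValueOrbit_lt_succ hp (hk.trans_le ih)).le
  induction n with
  | zero => simpa using (by linarith)
  | succ n ih =>
    have h := norm_critValueOrbit_mul_le hp (hk.trans_le (hmono n))
    calc (‖critValueOrbit p k c‖ - 1) ^ (n + 1)
        ≤ ‖critValueOrbit p (k + n) c‖ * (‖critValueOrbit p (k + n) c‖ - 1) := by
          rw [pow_succ]
          gcongr
          · linarith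
          · exact hmono n
      _ ≤ _ := h

/-- The parameters whose critical orbit is bounded are those whose critical orbit
never leaves the disc of radius `r`, for any `r ≥ 2`. -/
lemma isBounded_range_critValueOrbit_iff {p : ℕ} (hp : 2 ≤ p) {r : ℝ} (hr : 2 ≤ r) (c : ℂ) :
    Bornology.IsBounded (range fun k => critValueOrbit p k c) ↔
      ∀ k, ‖critValueOrbit p k c‖ ≤ r := by
  refine ⟨fun h k => ?_, fun h => isBounded_iff_forall_norm_le.2 ⟨r, ?_⟩⟩
  · by_contra! hk
    obtain ⟨C, hC⟩ := isBounded_iff_forall_norm_le.1 h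
    obtain ⟨n, hn⟩ := pow_unbounded_of_one_lt C
      (show 1 < ‖critValueOrbit p k c‖ - 1 by linarith)
    have := geometric_growth_critValueOrbit hp (hr.trans_lt hk) n
    linarith [hC _ (mem_range_self (k + n))]
  · rintro _ ⟨k, rfl⟩
    exact h k

/-- Pairs `(c, t)` for which the first `m` points of the orbit of `c` lie strictly inside the
disc of radius `‖t‖⁻¹ ^ n`. -/
def orbitDomain (p m n : ℕ) : Set (ℂ × ℂ) :=
  {x | ∀ j < m, ‖critValueOrbit p j x.1‖ * ‖x.2‖ ^ n < 1}

lemma isOpen_orbitDomain (p m n : ℕ) : IsOpen (orbitDomain p m n) := by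
  rw [show orbitDomain p m n =
    ⋂ j ∈ Iio m, {x : ℂ × ℂ | ‖critValueOrbit p j x.1‖ * ‖x.2‖ ^ n < 1} by
      ext; simp [orbitDomain]]
  refine (finite_Iio m).isOpen_biInter fun j _ => isOpen_lt ?_ continuous_const
  have := continuous_critValueOrbit p j
  fun_prop

lemma smul_mem_orbitDomain {p m n : ℕ} {x : ℂ × ℂ} (hx : x ∈ orbitDomain p m n) {a : ℝ}
    (ha₀ : 0 ≤ a) (ha₁ : a ≤ 1) : (x.1, (a : ℂ) * x.2) ∈ orbitDomain p m n := by
  intro j hj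
  refine lt_of_le_of_lt ?_ (hx j hj)
  gcongr
  simpa [abs_of_nonneg ha₀] using mul_le_of_le_one_left (norm_nonneg x.2) ha₁

lemma mk_zero_mem_orbitDomain (p m : ℕ) {n : ℕ} (hn : n ≠ 0) (c : ℂ) :
    (c, 0) ∈ orbitDomain p m n := by
  intro j _
  simp [hn]

lemma isSimplyConnected_orbitDomain (p m : ℕ) {n : ℕ} (hn : n ≠ 0) :
    IsSimplyConnected (orbitDomain p m n) := by
  have hcontr : ContractibleSpace (orbitDomain p m n) := by
    rw [contractible_iff_id_nullhomotopic]
    refine ⟨⟨(0, 0), mk_zero_mem_orbitDomain p m hn 0⟩, ?_⟩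
    let f : C(orbitDomain p m n, orbitDomain p m n) :=
      ⟨fun x => ⟨(x.1.1, 0), mk_zero_mem_orbitDomain p m hn _⟩, by fun_prop⟩
    refine .trans (g := f) (.symm ⟨⟨⟨fun x => ⟨(x.2.1.1, ((x.1 : ℝ) : ℂ) * x.2.1.2),
      smul_mem_orbitDomain x.2.2 x.1.2.1 x.1.2.2⟩, by fun_prop⟩, ?_, ?_⟩⟩)
      (.symm ⟨⟨⟨fun x => ⟨(((x.1 : ℝ) : ℂ) * x.2.1.1, 0),
      mk_zero_mem_orbitDomain p m hn _⟩, by fun_prop⟩, ?_, ?_⟩⟩)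
    all_goals intro x; ext <;> simp [f]
  exact SimplyConnectedSpace.ofContractible _

/-- A choice, over all parameters at once, of inverse branches `t ↦ χ (c, t) / t` conjugating
the `k`-th iterate of `z ↦ z ^ p + c` near infinity to the power map `w ↦ w ^ p ^ k`
in the coordinate `w = t⁻¹`. -/
structure IsBranch (p k : ℕ) (χ : ℂ × ℂ → ℂ) : Prop where
  continuousOn : ContinuousOn χ (orbitDomain p k (p ^ k))
  ne_zero : ∀ x ∈ orbitDomain p k (p ^ k), χ x ≠ 0
  iterate_eq : ∀ c t, (c, t) ∈ orbitDomain p k (p ^ k) → t ≠ 0 →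
    (unicritical p c)^[k] (χ (c, t) / t) = (t ^ p ^ k)⁻¹
  injective : ∀ c t t', (c, t) ∈ orbitDomain p k (p ^ k) → (c, t') ∈ orbitDomain p k (p ^ k) →
    t ≠ 0 → t' ≠ 0 → χ (c, t) / t = χ (c, t') / t' → t = t'
  surjective : ∀ c z, (unicritical p c)^[k] z ≠ 0 →
    (∀ j < k, ‖critValueOrbit p j c‖ < ‖(unicritical p c)^[k] z‖) →
    ∃ t, t ≠ 0 ∧ (c, t) ∈ orbitDomain p k (p ^ k) ∧ χ (c, t) / t = z

lemma isBranch_zero (p : ℕ) : IsBranch p 0 fun _ => 1 where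
  continuousOn := continuousOn_const
  ne_zero _ _ := one_ne_zero
  iterate_eq _ _ _ _ := by simp
  injective _ _ _ _ _ _ _ h := by simpa using h
  surjective c z hz _ := ⟨z⁻¹, inv_ne_zero hz, fun _ hj => absurd hj (by simp), by simp⟩

lemma orbitDomain_mono {p m m' n : ℕ} (h : m ≤ m') : orbitDomain p m' n ⊆ orbitDomain p m n :=
  fun _ hx j hj => hx j (hj.trans_le h)

lemma IsBranch.sub_mul_ne_zero {p k : ℕ} {χ : ℂ × ℂ → ℂ} (hχ : IsBranch p k χ)
    {c s : ℂ} (hx : (c, s) ∈ orbitDomain p (k + 1) (p ^ k)) : χ (c, s) - c * s ≠ 0 := by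
  intro h
  have hx' := orbitDomain_mono k.le_succ hx
  rcases eq_or_ne s 0 with rfl | hs
  · exact hχ.ne_zero _ hx' (by simpa using h)
  have hc : χ (c, s) / s = c := by
    rw [div_eq_iff hs]; linear_combination h
  have h₁ := hχ.iterate_eq c s hx' hs
  rw [hc] at h₁
  have h₂ := hx k k.lt_succ_self
  simp [critValueOrbit, h₁, hs] at h₂

lemma mk_pow_mem_orbitDomain_iff {p m k : ℕ} {c t : ℂ} :
    (c, t ^ p) ∈ orbitDomain p m (p ^ k) ↔ (c, t) ∈ orbitDomain p m (p ^ (k + 1)) := by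
  simp [orbitDomain, ← pow_mul, pow_succ']

lemma IsBranch.exists_succ {p k : ℕ} (hp : p ≠ 0) {χ : ℂ × ℂ → ℂ} (hχ : IsBranch p k χ) :
    ∃ χ', IsBranch p (k + 1) χ' := by
  obtain ⟨g, hg, hgp⟩ := Complex.exists_continuousOn_pow_eq
    (isSimplyConnected_orbitDomain p (k + 1) (pow_ne_zero k hp)) (isOpen_orbitDomain _ _ _)
    (g := fun x => χ x - x.1 * x.2)
    ((hχ.continuousOn.mono (orbitDomain_mono k.le_succ)).sub (by fun_prop))
    (by rintro ⟨⟨c, s⟩, hx, h⟩; exact hχ.sub_mul_ne_zero hx h) hp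
  have hne : ∀ x ∈ orbitDomain p (k + 1) (p ^ (k + 1)), g (x.1, x.2 ^ p) ≠ 0 := by
    intro x hx h
    apply hχ.sub_mul_ne_zero (mk_pow_mem_orbitDomain_iff.2 hx)
    rw [← hgp (x.1, x.2 ^ p), h, zero_pow hp]
  have hstep : ∀ c t, t ≠ 0 →
      unicritical p c (g (c, t ^ p) / t) = χ (c, t ^ p) / t ^ p := by
    intro c t ht
    rw [unicritical, div_pow, hgp]
    field_simp
    ring
  refine ⟨fun x => g (x.1, x.2 ^ p), ?_, hne, ?_, ?_, ?_⟩
  · exact hg.comp (by fun_prop) fun x hx => mk_pow_mem_orbitDomain_iff.2 hx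
  · intro c t hx ht
    have hx' := orbitDomain_mono k.le_succ (mk_pow_mem_orbitDomain_iff.2 hx)
    rw [Function.iterate_succ_apply, hstep c t ht, hχ.iterate_eq c _ hx' (pow_ne_zero p ht),
      ← pow_mul, pow_succ']
  · intro c t t' hx hx' ht ht' h
    have hs := orbitDomain_mono k.le_succ (mk_pow_mem_orbitDomain_iff.2 hx)
    have hs' := orbitDomain_mono k.le_succ (mk_pow_mem_orbitDomain_iff.2 hx')
    have hpow : t ^ p = t' ^ p := by
      refine hχ.injective c _ _ hs hs' (pow_ne_zero p ht) (pow_ne_zero p ht') ?_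
      rw [← hstep c t ht, ← hstep c t' ht']
      exact congrArg _ h
    have hgt := hne _ hx
    simp only [← hpow] at h hgt
    rw [div_eq_div_iff ht ht'] at h
    exact (mul_left_cancel₀ hgt h).symm
  · intro c z hz hlt
    rw [Function.iterate_succ_apply] at hz hlt
    obtain ⟨s, hs, hx, hsz⟩ := hχ.surjective c (unicritical p c z) hz
      fun j hj => hlt j (hj.trans k.lt_succ_self)
    have hx' : (c, s) ∈ orbitDomain p (k + 1) (p ^ k) := by
      intro j hj
      have := hlt j hj
      rw [← hsz, hχ.iterate_eq c s hx hs, norm_inv, norm_pow] at this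
      rwa [← one_div, lt_div_iff₀ (by positivity)] at this
    have hgs : g (c, s) ^ p = s * z ^ p := by
      rw [hgp, show χ (c, s) = unicritical p c z * s from (div_eq_iff hs).1 hsz, unicritical]
      ring
    have hg0 : g (c, s) ≠ 0 := fun h =>
      hχ.sub_mul_ne_zero hx' (by rw [← hgp (c, s), h, zero_pow hp])
    have hz0 : z ≠ 0 := by
      rintro rfl
      exact hg0 (by simpa [hp] using hgs)
    have ht : (g (c, s) / z) ^ p = s := by
      rw [div_pow, hgs, mul_div_cancel_right₀ _ (pow_ne_zero p hz0)]
    refine ⟨g (c, s) / z, div_ne_zero hg0 hz0, ?_, ?_⟩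
    · rwa [← mk_pow_mem_orbitDomain_iff, ht]
    · simp only [ht]
      field_simp

lemma exists_isBranch {p : ℕ} (hp : p ≠ 0) (k : ℕ) : ∃ χ, IsBranch p k χ := by
  induction k with
  | zero => exact ⟨_, isBranch_zero p⟩
  | succ k ih => exact ih.choose_spec.exists_succ hp

/-- Outside the lemniscate `‖critValueOrbit p k c‖ ≤ 2`, the function `critValueOrbit p k` has
a continuous `p ^ k`-th root. -/
lemma exists_continuousOn_pow_eq_critValueOrbit {p : ℕ} (hp : 2 ≤ p) (k : ℕ) :
    ∃ h : ℂ → ℂ, ContinuousOn h {c | 2 < ‖critValueOrbit p k c‖} ∧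
      ∀ c, 2 < ‖critValueOrbit p k c‖ → h c ^ p ^ k = critValueOrbit p k c := by
  obtain ⟨χ, hχ⟩ := exists_isBranch (show p ≠ 0 by lia) k
  have hex : ∀ c, ∃ t, 2 < ‖critValueOrbit p k c‖ →
      t ≠ 0 ∧ (c, t) ∈ orbitDomain p k (p ^ k) ∧ χ (c, t) / t = c := by
    intro c
    by_cases hc : 2 < ‖critValueOrbit p k c‖
    · obtain ⟨t, ht⟩ := hχ.surjective c c (norm_pos_iff.1 (lt_trans two_pos hc))
        fun j hj => norm_critValueOrbit_lt_of_lt hp hj hc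
      exact ⟨t, fun _ => ht⟩
    · exact ⟨0, fun h => absurd h hc⟩
  choose t ht using hex
  have hpow : ∀ c, 2 < ‖critValueOrbit p k c‖ → critValueOrbit p k c = (t c ^ p ^ k)⁻¹ := by
    intro c hc
    obtain ⟨h₀, hx, h⟩ := ht c hc
    rw [← hχ.iterate_eq c (t c) hx h₀, h, critValueOrbit]
  have hN : p ^ k ≠ 0 := pow_ne_zero k (by lia)
  have hopen : IsOpen {c | 2 < ‖critValueOrbit p k c‖} :=
    isOpen_lt continuous_const (continuous_critValueOrbit p k).norm
  refine ⟨fun c => (t c)⁻¹, fun c hc => ?_, fun c hc => by simp [hpow c hc]⟩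
  refine (Tendsto.inv₀ ?_ (ht c hc).1).mono_left inf_le_left
  have hev : ∀ᶠ b in 𝓝 c, 2 < ‖critValueOrbit p k b‖ := hopen.mem_nhds hc
  refine (isCompact_closedBall (0 : ℂ) 1).tendsto_nhds_of_unique_mapClusterPt ?_ ?_
  · filter_upwards [hev] with b hb
    have h₁ := hpow b hb
    rw [h₁, norm_inv, norm_pow] at hb
    rw [mem_closedBall_zero_iff]
    by_contra! h
    have := inv_le_one_of_one_le₀ (one_le_pow₀ h.le (n := p ^ k))
    linarith
  · intro y _ hy
    obtain ⟨U, hU, hty⟩ := mapClusterPt_iff_ultrafilter.1 hy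
    have hevU := hU hev
    have hy₁ : critValueOrbit p k c * y ^ p ^ k = 1 := by
      refine tendsto_nhds_unique (((continuous_critValueOrbit p k).continuousAt.mono_left hU).mul
        (hty.pow (p ^ k))) (tendsto_const_nhds.congr' ?_)
      filter_upwards [hevU] with b hb
      rw [hpow b hb, inv_mul_cancel₀ (pow_ne_zero _ (ht b hb).1)]
    have hy₀ : y ≠ 0 := by
      intro h₀
      rw [h₀, zero_pow hN, mul_zero] at hy₁
      exact zero_ne_one hy₁
    have hymem : (c, y) ∈ orbitDomain p k (p ^ k) := by
      intro j hj
      have h₁ : ‖critValueOrbit p k c‖ * ‖y‖ ^ p ^ k = 1 := by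
        rw [← norm_pow, ← norm_mul, hy₁, norm_one]
      rw [← h₁]
      exact mul_lt_mul_of_pos_right (norm_critValueOrbit_lt_of_lt hp hj hc)
        (pow_pos (norm_pos_iff.2 hy₀) _)
    have hUid : Tendsto (fun b => b) U (𝓝 c) := hU
    have hχy : χ (c, y) = c * y := by
      refine tendsto_nhds_unique (((hχ.continuousOn.continuousAt
        ((isOpen_orbitDomain p k _).mem_nhds hymem)).tendsto).comp (hUid.prodMk_nhds hty))
        ((hUid.mul hty).congr' ?_)
      filter_upwards [hevU] with b hb
      exact ((div_eq_iff (ht b hb).1).1 (ht b hb).2.2).symm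
    refine hχ.injective c _ _ hymem (ht c hc).2.1 hy₀ (ht c hc).1 ?_
    rw [(ht c hc).2.2, hχy, mul_div_cancel_right₀ _ hy₀]

lemma IsOpen.differentiableOn_of_pow_eq {f g : ℂ → ℂ} {U : Set ℂ} {N : ℕ} (hU : IsOpen U)
    (hN : N ≠ 0) (hf : DifferentiableOn ℂ f U) (hf₀ : ∀ z ∈ U, f z ≠ 0) (hg : ContinuousOn g U)
    (hpow : ∀ z ∈ U, g z ^ N = f z) : DifferentiableOn ℂ g U := by
  intro z hz
  have hg₀ : g z ≠ 0 := fun h => hf₀ z hz (by rw [← hpow z hz, h, zero_pow hN])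
  have hfz := (hf.differentiableAt (hU.mem_nhds hz)).hasDerivAt
  have hgz : ContinuousAt g z := hg.continuousAt (hU.mem_nhds hz)
  let S : ℂ → ℂ := fun w => ∑ i ∈ Finset.range N, g w ^ i * g z ^ (N - 1 - i)
  have hS : Tendsto S (𝓝 z) (𝓝 (S z)) :=
    tendsto_finsetSum _ fun i _ => (hgz.tendsto.pow i).mul tendsto_const_nhds
  have hSz : S z ≠ 0 := by
    have : S z = N * g z ^ (N - 1) := by
      simp only [S]
      rw [Finset.sum_congr rfl fun i hi => by
        rw [← pow_add, Nat.add_sub_cancel' (Nat.le_sub_one_of_lt (Finset.mem_range.1 hi))]]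
      simp
    rw [this]
    exact mul_ne_zero (Nat.cast_ne_zero.2 hN) (pow_ne_zero _ hg₀)
  refine (HasDerivAt.differentiableAt (f' := deriv f z / S z) ?_).differentiableWithinAt
  rw [hasDerivAt_iff_tendsto_slope] at hfz ⊢
  refine (hfz.div (hS.mono_left inf_le_left) hSz).congr' ?_
  filter_upwards [(hS.eventually_ne hSz).filter_mono inf_le_left,
    (hU.eventually_mem hz).filter_mono inf_le_left] with w hw hwU
  have h := (Commute.all (g w) (g z)).geom_sum₂_mul N
  rw [hpow w hwU, hpow z hz] at h
  rw [Pi.div_apply, slope_def_field, slope_def_field, ← h, div_eq_iff hw]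
  simp only [S]
  ring

lemma isPreconnected_norm_pow_mem {r R : ℝ} (hr : 0 < r) {N : ℕ} (hN : N ≠ 0) :
    IsPreconnected {w : ℂ | r < ‖w‖ ^ N ∧ ‖w‖ ^ N < R} := by
  have hpre : IsPreconnected (Complex.re ⁻¹' Ioo (Real.log r / N) (Real.log R / N)) :=
    ((convex_Ioo _ _).linear_preimage Complex.reLm).isPreconnected
  rcases le_or_gt R r with hR | hR
  · convert isPreconnected_empty
    ext w
    simp only [mem_ofPred_eq, mem_empty_iff_false, iff_false, not_and]
    intro h
    linarith
  convert hpre.image Complex.exp Complex.continuous_exp.continuousOn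
  have hN' : (0 : ℝ) < N := by positivity
  have key : ∀ z : ℂ, (r < ‖Complex.exp z‖ ^ N ∧ ‖Complex.exp z‖ ^ N < R) ↔
      z ∈ Complex.re ⁻¹' Ioo (Real.log r / N) (Real.log R / N) := by
    intro z
    rw [Complex.norm_exp, ← Real.exp_nat_mul, ← Real.log_lt_iff_lt_exp hr,
      ← Real.lt_log_iff_exp_lt (hr.trans hR), mem_preimage, mem_Ioo, div_lt_iff₀' hN',
      lt_div_iff₀' hN']
  ext w
  constructor
  · intro hw
    have hw₀ : w ≠ 0 := by
      rintro rfl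
      simp only [mem_ofPred_eq, norm_zero, zero_pow hN] at hw
      linarith [hw.1]
    exact ⟨Complex.log w, (key _).1 (by rwa [Complex.exp_log hw₀]), Complex.exp_log hw₀⟩
  · rintro ⟨z, hz, rfl⟩
    exact (key z).2 hz

lemma Complex.card_nthRootsFinset {N : ℕ} (hN : N ≠ 0) {a : ℂ} (ha : a ≠ 0) :
    (Polynomial.nthRootsFinset N a).card = N := by
  classical
  have hζ := Complex.isPrimitiveRoot_exp N hN
  rw [Polynomial.nthRootsFinset, ← Multiset.toFinset_eq (hζ.nthRoots_nodup ha), Finset.card_mk,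
    hζ.card_nthRoots, if_pos ⟨a ^ (1 / N : ℂ), by simp [hN]⟩]

/-- If a polynomial of degree at most `N` has a continuous `N`-th root outside the lemniscate
`‖P z‖ ≤ r`, then its level annuli outside this lemniscate are connected. -/
lemma Polynomial.isPreconnected_norm_eval_mem {P : Polynomial ℂ} {N : ℕ} {r : ℝ} (hr : 0 < r)
    (hP : 0 < P.degree) (hPN : P.natDegree ≤ N) {h : ℂ → ℂ}
    (hcont : ContinuousOn h {z | r < ‖P.eval z‖})
    (hpow : ∀ z, r < ‖P.eval z‖ → h z ^ N = P.eval z) (R : ℝ) :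
    IsPreconnected {z | r < ‖P.eval z‖ ∧ ‖P.eval z‖ < R} := by
  have hN : N ≠ 0 := by
    have := Polynomial.natDegree_pos_iff_degree_pos.2 hP
    lia
  set Ω := {z | r < ‖P.eval z‖} with hΩdef
  have hΩ : IsOpen Ω := isOpen_lt continuous_const P.continuous.norm
  have htop : Tendsto (fun z : ℂ => ‖P.eval z‖) (cocompact ℂ) atTop :=
    P.tendsto_norm_atTop hP (tendsto_norm_cocompact_atTop (E := ℂ))
  have hnorm : ∀ z ∈ Ω, ‖h z‖ ^ N = ‖P.eval z‖ := fun z hz => by rw [← norm_pow, hpow z hz]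
  have hdiff : DifferentiableOn ℂ h Ω := hΩ.differentiableOn_of_pow_eq hN
    P.differentiable.differentiableOn (fun z hz => norm_pos_iff.1 (hr.trans hz)) hcont hpow
  have hloc : ∀ z ∈ Ω, 𝓝 (h z) ≤ Filter.map h (𝓝 z) := by
    intro z hz
    refine (hdiff.analyticAt (hΩ.mem_nhds hz)).eventually_constant_or_nhds_le_map_nhds.resolve_left
      fun hconst => ?_
    have hev : ∀ᶠ w in 𝓝 z, (P - Polynomial.C (P.eval z)).eval w = 0 := by
      filter_upwards [hconst, hΩ.mem_nhds hz] with w hw hwΩ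
      rw [Polynomial.eval_sub, Polynomial.eval_C, ← hpow w hwΩ, hw, hpow z hz, sub_self]
    have hzero := Polynomial.eq_zero_of_infinite_isRoot _ (infinite_of_mem_nhds z hev)
    rw [sub_eq_zero.1 hzero] at hP
    exact absurd Polynomial.degree_C_le (not_le.2 hP)
  have hsurj : {w : ℂ | r < ‖w‖ ^ N} ⊆ h '' Ω := by
    have himg : IsOpen (h '' Ω) := isOpen_iff_mem_nhds.2 <| by
      rintro _ ⟨z, hz, rfl⟩
      exact hloc z hz (image_mem_map (hΩ.mem_nhds hz))
    have hfull : IsPreconnected {w : ℂ | r < ‖w‖ ^ N} := by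
      refine isPreconnected_of_forall_pair fun a ha b hb =>
        ⟨{w | r < ‖w‖ ^ N ∧ ‖w‖ ^ N < ‖a‖ ^ N + ‖b‖ ^ N + 1}, ?_, ⟨ha, ?_⟩, ⟨hb, ?_⟩,
          isPreconnected_norm_pow_mem hr hN⟩
      · exact fun _ h => h.1
      · have : 0 ≤ ‖b‖ ^ N := by positivity
        linarith
      · have : 0 ≤ ‖a‖ ^ N := by positivity
        linarith
    refine hfull.subset_of_closure_inter_subset himg ?_ ?_
    · obtain ⟨z, hz⟩ := (htop.eventually_gt_atTop r).exists
      exact ⟨h z, by simpa [hnorm z hz] using hz, z, hz, rfl⟩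
    · rintro w ⟨hw, hrw⟩
      obtain ⟨u, hu, hlim⟩ := mem_closure_iff_seq_limit.1 hw
      choose z hz hzu using hu
      have hPz : Tendsto (fun n => P.eval (z n)) atTop (𝓝 (w ^ N)) := by
        refine (hlim.pow N).congr fun n => ?_
        rw [← hzu, hpow _ (hz n)]
      obtain ⟨K, hK, hKsub⟩ := mem_cocompact.1 (htop.eventually_gt_atTop (‖w ^ N‖ + 1))
      have hevK : ∀ᶠ n in atTop, z n ∈ K := by
        filter_upwards [hPz.norm.eventually_lt_const (lt_add_one _)] with n hn
        by_contra hnK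
        exact lt_asymm hn (hKsub hnK)
      obtain ⟨b, _, φ, hφ, hb⟩ := hK.tendsto_subseq' hevK.frequently
      have hPb : P.eval b = w ^ N :=
        tendsto_nhds_unique ((P.continuous.tendsto b).comp hb) (hPz.comp hφ.tendsto_atTop)
      have hbΩ : b ∈ Ω := by simpa [Ω, hPb] using hrw
      refine ⟨b, hbΩ, tendsto_nhds_unique
        (((hcont.continuousAt (hΩ.mem_nhds hbΩ)).tendsto).comp hb) ?_⟩
      refine (hlim.comp hφ.tendsto_atTop).congr fun n => (hzu _).symm
  have hinj : InjOn h Ω := by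
    intro a ha b hb hab
    have ha₀ : P.eval a ≠ 0 := norm_pos_iff.1 (hr.trans ha)
    have hPab : P.eval b = P.eval a := by rw [← hpow b hb, ← hab, hpow a ha]
    have hne : P - Polynomial.C (P.eval a) ≠ 0 := fun h₀ => by
      rw [sub_eq_zero.1 h₀] at hP
      exact absurd Polynomial.degree_C_le (not_le.2 hP)
    classical
    have hmem : ∀ z, z ∈ (P - Polynomial.C (P.eval a)).roots.toFinset ↔ P.eval z = P.eval a := by
      intro z
      simp [hne, sub_eq_zero]
    have hΩmem : ∀ z, P.eval z = P.eval a → z ∈ Ω := fun z hz => by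
      rw [hΩdef, mem_ofPred_eq, hz]; exact ha
    refine Finset.injOn_of_surjOn_of_card_le (s := (P - Polynomial.C (P.eval a)).roots.toFinset)
      (t := Polynomial.nthRootsFinset N (P.eval a)) h ?_ ?_ ?_ ((hmem a).2 rfl)
      ((hmem b).2 hPab) hab
    · intro z hz
      have hz' := (hmem z).1 hz
      rw [Finset.mem_coe, Polynomial.mem_nthRootsFinset (Nat.pos_of_ne_zero hN),
        hpow z (hΩmem z hz'), hz']
    · intro w hw
      rw [Finset.mem_coe, Polynomial.mem_nthRootsFinset (Nat.pos_of_ne_zero hN)] at hw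
      obtain ⟨z, hz, rfl⟩ := hsurj (show r < ‖w‖ ^ N by rw [← norm_pow, hw]; exact ha)
      exact ⟨z, (hmem z).2 (by rw [← hpow z hz, hw]), rfl⟩
    · rw [Complex.card_nthRootsFinset hN ha₀]
      calc _ ≤ Multiset.card (P - Polynomial.C (P.eval a)).roots := Multiset.toFinset_card_le _
        _ ≤ (P - Polynomial.C (P.eval a)).natDegree := Polynomial.card_roots' _
        _ ≤ N := by rwa [Polynomial.natDegree_sub_C]
  have hopen : IsOpenMap fun z : Ω => h z := by
    refine IsOpenMap.of_nhds_le fun z => (hloc z z.2).trans_eq ?_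
    rw [← hΩ.isOpenEmbedding_subtypeVal.map_nhds_eq z, Filter.map_map]
    rfl
  have hpre := (isPreconnected_norm_pow_mem (R := R) hr hN).preimage_of_isOpenMap
    (f := fun z : Ω => h z) (fun a b hab => Subtype.ext (hinj a.2 b.2 hab)) hopen ?_
  · convert hpre.image Subtype.val continuous_subtype_val.continuousOn
    ext z
    constructor
    · rintro ⟨h₁, h₂⟩
      refine ⟨⟨z, h₁⟩, ?_, rfl⟩
      rw [mem_preimage, mem_ofPred_eq, hnorm z h₁]
      exact ⟨h₁, h₂⟩
    · rintro ⟨⟨z, hz⟩, hzR, rfl⟩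
      rwa [mem_preimage, mem_ofPred_eq, hnorm z hz] at hzR
  · intro w hw
    obtain ⟨z, hz, rfl⟩ := hsurj hw.1
    exact ⟨⟨z, hz⟩, rfl⟩

/-- The Multibrot set of degree `p` is connected. -/
lemma isConnected_multibrot {p : ℕ} (hp : 2 ≤ p) :
    IsConnected {c : ℂ | ∀ k, ‖critValueOrbit p k c‖ ≤ 2} := by
  set M := {c : ℂ | ∀ k, ‖critValueOrbit p k c‖ ≤ 2}
  have hcont : ∀ k, Continuous fun c => ‖critValueOrbit p k c‖ :=
    fun k => (continuous_critValueOrbit p k).norm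
  have h0 : ∀ k, critValueOrbit p k 0 = 0 := by
    intro k
    induction k with
    | zero => rfl
    | succ k ih => rw [critValueOrbit_succ, ih, add_zero, zero_pow (by lia)]
  refine ⟨⟨0, fun k => by simp [h0 k]⟩, ?_⟩
  have hcpt : ∀ k, IsCompact {c | ‖critValueOrbit p k c‖ ≤ 3} := by
    intro k
    refine (isCompact_closedBall (0 : ℂ) 3).of_isClosed_subset
      (isClosed_le (hcont k) continuous_const) fun c hc => ?_
    rw [mem_ofPred_eq] at hc
    rw [mem_closedBall_zero_iff]
    rcases le_total 2 ‖c‖ with h | h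
    · exact (norm_le_norm_critValueOrbit hp h k).trans hc
    · linarith
  have hanti : Antitone fun k => {c | ‖critValueOrbit p k c‖ ≤ 3} := by
    refine antitone_nat_of_succ_le fun k c hc => ?_
    by_contra hk
    rw [mem_ofPred_eq, not_le] at hk
    rw [mem_ofPred_eq] at hc
    linarith [norm_critValueOrbit_lt_succ hp (show 2 < ‖critValueOrbit p k c‖ by linarith)]
  have hMiff : M = ⋂ k, {c | ‖critValueOrbit p k c‖ ≤ 3} := by
    ext c
    rw [mem_iInter]
    exact (isBounded_range_critValueOrbit_iff hp le_rfl c).symm.trans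
      (isBounded_range_critValueOrbit_iff hp (by norm_num) c)
  have hannulus : ∀ k, IsPreconnected
      {c | 2 < ‖critValueOrbit p k c‖ ∧ ‖critValueOrbit p k c‖ < 3} := by
    intro k
    obtain ⟨P, hPdeg, hPe⟩ := exists_polynomial_critValueOrbit (show 1 ≤ p by lia) k
    obtain ⟨h, hh, hpow⟩ := exists_continuousOn_pow_eq_critValueOrbit hp k
    simp only [← hPe] at hh hpow ⊢
    refine P.isPreconnected_norm_eval_mem two_pos ?_ hPdeg hh hpow 3
    by_contra! hdeg
    rw [Polynomial.eq_C_of_degree_le_zero hdeg] at hPe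
    have h₁ := hPe 0
    rw [Polynomial.eval_C] at h₁
    have h₂ := norm_le_norm_critValueOrbit hp (c := 2) (by simp) k
    rw [← hPe 2, Polynomial.eval_C, h₁, h0] at h₂
    norm_num at h₂
  have key : ∀ u v : Set ℂ, IsOpen u → IsOpen v → Disjoint u v → ∀ k,
      {c | ‖critValueOrbit p k c‖ ≤ 3} ⊆ u ∪ v →
      {c | 2 < ‖critValueOrbit p k c‖ ∧ ‖critValueOrbit p k c‖ < 3} ⊆ u → ¬ (M ∩ v).Nonempty := by
    rintro u v hu hv huv k hsub hann ⟨b, hbM, hbv⟩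
    have hlt_le : v ∩ {c | ‖critValueOrbit p k c‖ < 3} = {c | ‖critValueOrbit p k c‖ ≤ 2} \ u := by
      ext c
      constructor
      · rintro ⟨hcv, hc⟩
        have hcu : c ∉ u := fun hcu => disjoint_left.1 huv hcu hcv
        exact ⟨not_lt.1 fun h => hcu (hann ⟨h, hc⟩), hcu⟩
      · rintro ⟨hc, hcu⟩
        rw [mem_ofPred_eq] at hc
        exact ⟨(hsub (show ‖critValueOrbit p k c‖ ≤ 3 by linarith)).resolve_left hcu,
          show ‖critValueOrbit p k c‖ < 3 by linarith⟩
    have hclopen : IsClopen (v ∩ {c | ‖critValueOrbit p k c‖ < 3}) := by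
      refine ⟨?_, hv.inter (isOpen_lt (hcont k) continuous_const)⟩
      rw [hlt_le]
      exact (isClosed_le (hcont k) continuous_const).sdiff hu
    have huniv := hclopen.eq_univ
      ⟨b, hbv, show ‖critValueOrbit p k b‖ < 3 by linarith [hbM k]⟩
    have h₁ : (3 : ℂ) ∈ v ∩ {c | ‖critValueOrbit p k c‖ < 3} := huniv ▸ mem_univ _
    have h₂ := norm_le_norm_critValueOrbit hp (c := 3) (by norm_num) k
    have h₃ : ‖critValueOrbit p k 3‖ < 3 := h₁.2
    norm_num at h₂
    linarith
  have hMclosed : IsClosed M := by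
    rw [hMiff]
    exact isClosed_iInter fun k => (hcpt k).isClosed
  rw [isPreconnected_iff_subset_of_fully_disjoint_closed hMclosed]
  intro A B hA hB hMAB hAB
  obtain ⟨u, v, hu, hv, hAu, hBv, huv⟩ := normal_separation hA hB hAB
  obtain ⟨k, hk⟩ := exists_subset_nhds_of_isCompact hanti.directed_ge hcpt (U := u ∪ v) (by
    rw [← hMiff]
    exact fun c hc => (hu.union hv).mem_nhds (union_subset_union hAu hBv (hMAB hc)))
  have hsub : {c | 2 < ‖critValueOrbit p k c‖ ∧ ‖critValueOrbit p k c‖ < 3} ⊆ u ∪ v :=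
    fun c hc => hk hc.2.le
  rcases isPreconnected_iff_subset_of_disjoint.1 (hannulus k) u v hu hv hsub
    (by rw [huv.inter_eq, inter_empty]) with h | h
  · refine Or.inl fun c hc => (hMAB hc).resolve_right fun hcB => ?_
    exact key u v hu hv huv k hk h ⟨c, hc, hBv hcB⟩
  · refine Or.inr fun c hc => (hMAB hc).resolve_left fun hcA => ?_
    exact key v u hv hu huv.symm k (by rwa [union_comm]) h ⟨c, hc, hAu hcA⟩

lemma iterate_prod_pow_add (p : ℕ) (c : ℂ × ℂ) (m : ℕ) :
    (fun v : ℂ × ℂ => v ^ p + c)^[m] 0 =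
      ((unicritical p c.1)^[m] 0, (unicritical p c.2)^[m] 0) := by
  rw [show (fun v : ℂ × ℂ => v ^ p + c) = Prod.map (unicritical p c.1) (unicritical p c.2) from rfl,
    Prod.map_iterate]
  rfl

lemma isBounded_range_iterate_zero_iff {p : ℕ} (hp : 2 ≤ p) (c : ℂ) :
    Bornology.IsBounded (range fun m => (unicritical p c)^[m] 0) ↔
      ∀ k, ‖critValueOrbit p k c‖ ≤ 2 := by
  have hsucc : ∀ k, (unicritical p c)^[k + 1] 0 = critValueOrbit p k c := by
    intro k
    rw [Function.iterate_succ_apply, unicritical, zero_pow (by lia), zero_add, critValueOrbit]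
  rw [← isBounded_range_critValueOrbit_iff hp le_rfl]
  refine ⟨fun h => h.subset ?_, fun h => (h.insert 0).subset ?_⟩
  · rintro _ ⟨k, rfl⟩
    exact ⟨k + 1, hsucc k⟩
  · rintro _ ⟨_ | k, rfl⟩
    · exact mem_insert _ _
    · exact mem_insert_of_mem _ ⟨k, (hsucc k).symm⟩

/-- The bicomplex Multibrot set `M_2^p` is a connected subset of `ℂ × ℂ`. -/
theorem bicomplex_multibrot_isConnected (p : ℕ) (hp : 2 ≤ p) :
    IsConnected {c : ℂ × ℂ | Bornology.IsBounded
        (Set.range fun m : ℕ => (fun v : ℂ × ℂ => v ^ p + c)^[m] 0)} := by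
  convert (isConnected_multibrot hp).prod (isConnected_multibrot hp)
  ext c
  rw [mem_prod, mem_ofPred_eq, mem_ofPred_eq, mem_ofPred_eq,
    ← isBounded_range_iterate_zero_iff hp, ← isBounded_range_iterate_zero_iff hp,
    ← Bornology.isBounded_image_fst_and_snd, ← range_comp, ← range_comp]
  simp only [Function.comp_def, iterate_prod_pow_add]
end

section
/- Let p ≥ 2 be an integer. In the four-fold idempotent representation of the tricomplex numbers as the product ring ℂ⁴, the tricomplex Multibrot set M_3^p = {c ∈ ℂ⁴ : the sequence (f_c^m(0))_{m≥1} is bounded}, where f_c(η) = η^p + c acts componentwise, equals the four-fold Cartesian product M^p × M^p × M^p × M^p of the complex Multibrot set, and M_3^p is a compact and connected subset of ℂ⁴. -/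
open Polynomial Set Filter Topology unitInterval

/-- Sets defined by an order-connected condition on the modulus are preconnected in `ℂ`. -/
theorem isPreconnected_setOf_norm_mem {s : Set ℝ} (hs : s.OrdConnected) :
    IsPreconnected {w : ℂ | ‖w‖ ∈ s} := by
  have hs' : IsPreconnected ((s ∩ Ici 0) ×ˢ (univ : Set ℝ)) :=
    (hs.inter ordConnected_Ici).isPreconnected.prod isPreconnected_univ
  convert hs'.image (fun x : ℝ × ℝ => (x.1 : ℂ) * Complex.exp (x.2 * Complex.I))
    (by fun_prop) using 1
  ext w
  simp only [mem_ofPred_eq, mem_image, mem_prod, mem_inter_iff, mem_Ici, mem_univ, and_true,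
    Prod.exists]
  constructor
  · exact fun hw => ⟨‖w‖, w.arg, ⟨hw, norm_nonneg w⟩, Complex.norm_mul_exp_arg_mul_I w⟩
  · rintro ⟨r, θ, ⟨hr, hr0⟩, rfl⟩
    simpa [Complex.norm_exp_ofReal_mul_I, abs_of_nonneg hr0] using hr

/-- A continuous map is open if its composition with a locally injective continuous map is. -/
theorem IsOpenMap.of_comp_isLocallyInjective {X Y Z : Type*} [TopologicalSpace X]
    [TopologicalSpace Y] [TopologicalSpace Z] {f : X → Y} {e : Y → Z} (hf : Continuous f)
    (he : Continuous e) (hinj : IsLocallyInjective e) (h : IsOpenMap (e ∘ f)) : IsOpenMap f := by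
  rw [isOpenMap_iff_nhds_le]
  intro x s hs
  obtain ⟨V, hVo, hxV, hV⟩ := hinj (f x)
  have hU : f ⁻¹' s ∩ f ⁻¹' V ∈ 𝓝 x :=
    inter_mem hs (hf.continuousAt.preimage_mem_nhds (hVo.mem_nhds hxV))
  have himg : e ⁻¹' ((e ∘ f) '' (f ⁻¹' s ∩ f ⁻¹' V)) ∈ 𝓝 (f x) :=
    he.continuousAt.preimage_mem_nhds (h.image_mem_nhds hU)
  filter_upwards [himg, hVo.mem_nhds hxV] with y ⟨u, ⟨hus, huV⟩, huy⟩ hyV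
  rwa [← hV huV hyV huy]

/-- A decreasing intersection of compact preconnected sets is preconnected. -/
theorem isPreconnected_iInter_of_antitone {X : Type*} [TopologicalSpace X] [T2Space X]
    [NormalSpace X] {K : ℕ → Set X} (hK : Antitone K) (hc : ∀ n, IsCompact (K n))
    (hconn : ∀ n, IsPreconnected (K n)) : IsPreconnected (⋂ n, K n) := by
  rw [isPreconnected_iff_subset_of_fully_disjoint_closed
    (isClosed_iInter fun n => (hc n).isClosed)]
  intro u v hu hv huv hd
  obtain ⟨U, V, hU, hV, huU, hvV, hUV⟩ := normal_separation hu hv hd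
  obtain ⟨n, hn⟩ := exists_subset_nhds_of_isCompact hK.directed_ge hc
    (U := U ∪ V) fun x hx =>
      (hU.union hV).mem_nhds (union_subset_union huU hvV (huv hx))
  have hsub : (⋂ n, K n) ⊆ K n := iInter_subset K n
  rcases (hconn n).subset_or_subset hU hV hUV hn with h | h
  · refine Or.inl fun x hx => (huv hx).resolve_right fun hxv => ?_
    exact hUV.le_bot ⟨h (hsub hx), hvV hxv⟩
  · refine Or.inr fun x hx => (huv hx).resolve_left fun hxu => ?_
    exact hUV.le_bot ⟨huU hxu, h (hsub hx)⟩

namespace Polynomial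

variable {P : ℂ[X]} {R : ℝ}

theorem isCompact_setOf_norm_eval_le (hP : 0 < P.natDegree) (R : ℝ) :
    IsCompact {c : ℂ | ‖P.eval c‖ ≤ R} := by
  refine Metric.isCompact_of_isClosed_isBounded
    (isClosed_le P.continuous.norm continuous_const) ?_
  have h := P.tendsto_norm_atTop (natDegree_pos_iff_degree_pos.1 hP)
    (tendsto_norm_cobounded_atTop (E := ℂ))
  have h' := h.eventually (eventually_gt_atTop R)
  rw [← Bornology.isCobounded_compl_iff]
  filter_upwards [h'] with c hc
  simpa using hc

theorem isOpenMap_eval (hP : 0 < P.natDegree) : IsOpenMap fun c : ℂ => P.eval c := by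
  have hA : AnalyticOnNhd ℂ (fun c : ℂ => P.eval c) univ := fun c _ => by
    simpa using AnalyticAt.aeval_polynomial (analyticAt_id (𝕜 := ℂ) (z := c)) P
  rcases hA.is_constant_or_isOpen isPreconnected_univ with ⟨w, hw⟩ | h
  · exfalso
    have : P = C w := Polynomial.funext fun c => by simpa using hw c (mem_univ c)
    simp [this] at hP
  · exact fun s hs => h s (subset_univ s) hs

section Root

variable {q : {c : ℂ // R < ‖P.eval c‖} → ℂ}

theorem isOpenMap_of_pow_eq_eval (hP : 0 < P.natDegree) (hR : 0 ≤ R) (hq : Continuous q)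
    (hqP : ∀ c, q c ^ P.natDegree = P.eval (c : ℂ)) : IsOpenMap q := by
  have hopen : IsOpen {c : ℂ | R < ‖P.eval c‖} := isOpen_lt continuous_const P.continuous.norm
  have hPne : ∀ c : {c : ℂ // R < ‖P.eval c‖}, P.eval (c : ℂ) ≠ 0 := fun c =>
    norm_pos_iff.1 (hR.trans_lt c.2)
  have hq0 : ∀ c, q c ≠ 0 := fun c h => hPne c (by rw [← hqP, h, zero_pow hP.ne'])
  have hcov := isCoveringMap_npow (𝕜 := ℂ) P.natDegree (by exact_mod_cast hP.ne')
  have hopen0 : IsOpen {z : ℂ | z ≠ 0} := isOpen_ne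
  have hQ : IsOpenMap fun c => (⟨q c, hq0 c⟩ : {z : ℂ // z ≠ 0}) := by
    refine IsOpenMap.of_comp_isLocallyInjective (by fun_prop) hcov.continuous
      hcov.isLocalHomeomorph.isLocallyInjective ?_
    rw [hopen0.isOpenEmbedding_subtypeVal.isOpenMap_iff]
    have hres : IsOpenMap fun c : {c : ℂ // R < ‖P.eval c‖} => P.eval (c : ℂ) :=
      (isOpenMap_eval hP).comp hopen.isOpenEmbedding_subtypeVal.isOpenMap
    rwa [← _root_.funext hqP] at hres
  exact hopen0.isOpenEmbedding_subtypeVal.isOpenMap.comp hQ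

theorem lt_norm_pow_of_pow_eq_eval (hqP : ∀ c, q c ^ P.natDegree = P.eval (c : ℂ))
    (c : {c : ℂ // R < ‖P.eval c‖}) : R < ‖q c‖ ^ P.natDegree := by
  rw [← norm_pow, hqP]
  exact c.2

theorem isPreconnected_setOf_lt_norm_pow (N : ℕ) (R : ℝ) :
    IsPreconnected {w : ℂ | R < ‖w‖ ^ N} := by
  have h := isPreconnected_setOf_norm_mem (s := {r : ℝ | 0 ≤ r ∧ R < r ^ N}) (by
    refine ⟨fun a ha b _ x hx => ⟨ha.1.trans hx.1, ha.2.trans_le ?_⟩⟩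
    have := ha.1
    have := hx.1
    gcongr)
  simpa using h

theorem range_eq_of_pow_eq_eval (hP : 0 < P.natDegree) (hR : 0 ≤ R) (hq : Continuous q)
    (hqP : ∀ c, q c ^ P.natDegree = P.eval (c : ℂ)) :
    range q = {w : ℂ | R < ‖w‖ ^ P.natDegree} := by
  refine Subset.antisymm (range_subset_iff.2 fun c => lt_norm_pow_of_pow_eq_eval hqP c) ?_
  refine (isPreconnected_setOf_lt_norm_pow P.natDegree R).subset_of_closure_inter_subset
    (isOpenMap_of_pow_eq_eval hP hR hq hqP).isOpen_range ?_ ?_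
  · obtain ⟨c, hc⟩ := IsAlgClosed.exists_eval₂_eq_zero_of_injective (RingHom.id ℂ)
      (RingHom.id ℂ).injective (P - C ((R + 1 : ℝ) : ℂ)) (by
        rw [degree_sub_C (natDegree_pos_iff_degree_pos.1 hP)]
        exact (natDegree_pos_iff_degree_pos.1 hP).ne')
    have hc' : P.eval c = ((R + 1 : ℝ) : ℂ) := by
      simpa [eval₂_id, sub_eq_zero] using hc
    have hcR : R < ‖P.eval c‖ := by
      rw [hc', Complex.norm_real, Real.norm_of_nonneg (by linarith)]
      linarith
    exact ⟨q ⟨c, hcR⟩, lt_norm_pow_of_pow_eq_eval hqP _, mem_range_self _⟩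
  · rintro w ⟨hw, hwR⟩
    obtain ⟨x, hx, hxw⟩ := mem_closure_iff_seq_limit.1 hw
    choose c hc using hx
    have hPc : Tendsto (fun k => P.eval (c k : ℂ)) atTop (𝓝 (w ^ P.natDegree)) := by
      simpa only [← hqP, hc] using hxw.pow P.natDegree
    obtain ⟨B, hB⟩ := (Metric.isBounded_range_of_tendsto _ hPc).exists_norm_le
    obtain ⟨a, -, φ, hφ, hφa⟩ := (isCompact_setOf_norm_eval_le hP B).tendsto_subseq
      (x := fun k => (c k : ℂ)) fun k => hB _ (mem_range_self k)
    have hPa : P.eval a = w ^ P.natDegree :=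
      tendsto_nhds_unique ((P.continuous.tendsto a).comp hφa) (hPc.comp hφ.tendsto_atTop)
    have haR : R < ‖P.eval a‖ := by rwa [hPa, norm_pow]
    have hca : Tendsto (fun k => c (φ k)) atTop (𝓝 ⟨a, haR⟩) :=
      tendsto_subtype_rng.2 hφa
    refine ⟨⟨a, haR⟩, tendsto_nhds_unique ((hq.tendsto _).comp hca) ?_⟩
    convert hxw.comp hφ.tendsto_atTop using 1
    ext k
    exact hc (φ k)

theorem injective_of_pow_eq_eval (hP : 0 < P.natDegree) (hR : 0 ≤ R) (hq : Continuous q)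
    (hqP : ∀ c, q c ^ P.natDegree = P.eval (c : ℂ)) : Function.Injective q := by
  classical
  intro a b hab
  have ha0 : P.eval (a : ℂ) ≠ 0 := norm_pos_iff.1 (hR.trans_lt a.2)
  have hPa : P - C (P.eval (a : ℂ)) ≠ 0 := fun h => by
    have := congrArg natDegree h
    simp [natDegree_sub_C] at this
    omega
  set S := (P - C (P.eval (a : ℂ))).roots.toFinset with hS
  set T := (nthRoots P.natDegree (P.eval (a : ℂ))).toFinset with hT
  have hmemS : ∀ c, c ∈ S ↔ P.eval c = P.eval (a : ℂ) := fun c => by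
    simp [hS, hPa, sub_eq_zero]
  have hmemT : ∀ w, w ∈ T ↔ w ^ P.natDegree = P.eval (a : ℂ) := fun w => by
    simp [hT, mem_nthRoots hP]
  have hcardS : S.card ≤ P.natDegree :=
    (Multiset.toFinset_card_le _).trans ((card_roots' _).trans (natDegree_sub_C).le)
  have hprim := Complex.isPrimitiveRoot_exp P.natDegree hP.ne'
  have hcardT : T.card = P.natDegree := by
    rw [hT, Multiset.toFinset_card_of_nodup (hprim.nthRoots_nodup ha0), hprim.card_nthRoots,
      if_pos ⟨q a, hqP a⟩]
  have hSR : ∀ c ∈ S, R < ‖P.eval c‖ := fun c hc => by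
    rw [(hmemS c).1 hc]
    exact a.2
  let g : ℂ → ℂ := fun c => if h : R < ‖P.eval c‖ then q ⟨c, h⟩ else 0
  have hg : ∀ c : {c : ℂ // R < ‖P.eval c‖}, g c = q c := fun c => dif_pos c.2
  have hmaps : MapsTo g S T := fun c hc => by
    have := hg ⟨c, hSR c hc⟩
    simp only at this
    rw [Finset.mem_coe, hmemT, this, hqP]
    exact (hmemS c).1 hc
  have hsurj : SurjOn g S T := fun w hw => by
    rw [Finset.mem_coe, hmemT] at hw
    have : w ∈ range q := by
      rw [range_eq_of_pow_eq_eval hP hR hq hqP, mem_ofPred_eq, ← norm_pow, hw]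
      exact a.2
    obtain ⟨c, rfl⟩ := this
    exact ⟨c, (hmemS c).2 ((hqP c).symm.trans hw), hg c⟩
  have hinj := Finset.injOn_of_surjOn_of_card_le g hmaps hsurj (hcardS.trans hcardT.ge)
  refine Subtype.ext (hinj ((hmemS a).2 rfl) ((hmemS b).2 ?_) ?_)
  · rw [← hqP, ← hqP, hab]
  · rw [hg, hg, hab]

theorem isPreconnected_setOf_norm_eval_mem_Ioo (hP : 0 < P.natDegree) (hR : 0 ≤ R)
    (hq : Continuous q) (hqP : ∀ c, q c ^ P.natDegree = P.eval (c : ℂ)) (R' : ℝ) :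
    IsPreconnected {c : ℂ | ‖P.eval c‖ ∈ Ioo R R'} := by
  have hA : IsPreconnected {w : ℂ | R < ‖w‖ ^ P.natDegree ∧ ‖w‖ ^ P.natDegree < R'} := by
    have h := isPreconnected_setOf_norm_mem
      (s := {r : ℝ | 0 ≤ r ∧ R < r ^ P.natDegree ∧ r ^ P.natDegree < R'}) (by
        refine ⟨fun a ha b hb x hx =>
          ⟨ha.1.trans hx.1, ha.2.1.trans_le ?_, lt_of_le_of_lt ?_ hb.2.2⟩⟩
        · have := ha.1
          have := hx.1
          gcongr
        · have := ha.1.trans hx.1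
          have := hx.2
          gcongr)
    simpa using h
  have hpre := hA.preimage_of_isOpenMap (injective_of_pow_eq_eval hP hR hq hqP)
    (isOpenMap_of_pow_eq_eval hP hR hq hqP) (by
      rw [range_eq_of_pow_eq_eval hP hR hq hqP]
      exact fun w hw => hw.1)
  convert hpre.image Subtype.val continuous_subtype_val.continuousOn using 1
  ext c
  simp only [mem_ofPred_eq, mem_Ioo, mem_image, mem_preimage, Subtype.exists, exists_and_right,
    exists_eq_right, ← norm_pow, hqP]
  exact ⟨fun h => ⟨⟨h.1, h.1⟩, h.2⟩, fun h => ⟨h.1.1, h.2⟩⟩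

/-- If `P` has a continuous `deg P`-th root outside the sublevel set `‖P‖ ≤ R`, then that sublevel
set is connected. -/
theorem isPreconnected_setOf_norm_eval_le (hP : 0 < P.natDegree) (hR : 0 ≤ R)
    (hq : Continuous q) (hqP : ∀ c, q c ^ P.natDegree = P.eval (c : ℂ)) :
    IsPreconnected {c : ℂ | ‖P.eval c‖ ≤ R} := by
  have hcl : IsClosed {c : ℂ | ‖P.eval c‖ ≤ R} :=
    isClosed_le P.continuous.norm continuous_const
  rw [isPreconnected_iff_subset_of_fully_disjoint_closed hcl]
  intro u v hu hv huv hd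
  obtain ⟨U, V, hU, hV, huU, hvV, hUV⟩ := normal_separation hu hv hd
  obtain ⟨R', hRR', hR'⟩ : ∃ R', R < R' ∧ {c : ℂ | ‖P.eval c‖ < R'} ⊆ U ∪ V := by
    have hcomp : IsCompact ({c : ℂ | ‖P.eval c‖ ≤ R + 1} \ (U ∪ V)) :=
      (isCompact_setOf_norm_eval_le hP _).diff (hU.union hV)
    rcases ({c : ℂ | ‖P.eval c‖ ≤ R + 1} \ (U ∪ V)).eq_empty_or_nonempty with he | hne
    · exact ⟨R + 1, by linarith, fun c hc => sdiff_eq_empty.1 he (mem_ofPred.2 (le_of_lt hc))⟩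
    · obtain ⟨a, ha, hmin⟩ := hcomp.exists_isMinOn hne P.continuous.norm.continuousOn
      refine ⟨‖P.eval a‖, ?_, fun c hc => ?_⟩
      · by_contra! h
        exact ha.2 (union_subset_union huU hvV (huv h))
      · by_contra hcUV
        exact absurd (mem_ofPred.1 hc) (hmin ⟨mem_ofPred.2 ((le_of_lt hc).trans ha.1), hcUV⟩).not_gt
  have key : ∀ A B : Set ℂ, IsOpen A → IsOpen B → Disjoint A B →
      {c : ℂ | ‖P.eval c‖ < R'} ⊆ A ∪ B → {c : ℂ | ‖P.eval c‖ ∈ Ioo R R'} ⊆ A →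
      {c : ℂ | ‖P.eval c‖ ≤ R} ⊆ A := by
    intro A B hA hB hAB hcov hann
    set D := B ∩ {c : ℂ | ‖P.eval c‖ < R'} with hD
    have hDopen : IsOpen D := hB.inter (isOpen_lt P.continuous.norm continuous_const)
    have hDeq : D = {c : ℂ | ‖P.eval c‖ ≤ R} \ A := by
      ext c
      constructor
      · rintro ⟨hcB, hc⟩
        have hcA : c ∉ A := fun h => hAB.le_bot ⟨h, hcB⟩
        exact ⟨not_lt.1 fun h => hcA (hann ⟨h, hc⟩), hcA⟩
      · rintro ⟨hc, hcA⟩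
        have hc' : ‖P.eval c‖ < R' := lt_of_le_of_lt hc hRR'
        exact ⟨(hcov hc').resolve_left hcA, hc'⟩
    have hDcomp : IsCompact D := hDeq ▸ (isCompact_setOf_norm_eval_le hP R).diff hA
    rcases isClopen_iff.1 (⟨hDcomp.isClosed, hDopen⟩ : IsClopen D) with h | h
    · exact sdiff_eq_empty.1 (hDeq ▸ h)
    · exact absurd (h ▸ hDcomp) (noncompact_univ ℂ)
  rcases (isPreconnected_setOf_norm_eval_mem_Ioo hP hR hq hqP R').subset_or_subset hU hV hUV
    (fun c hc => hR' hc.2) with h | h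
  · have hsub := key U V hU hV hUV hR' h
    exact Or.inl fun x hx => (huv hx).resolve_right fun hxv => hUV.le_bot ⟨hsub hx, hvV hxv⟩
  · have hsub := key V U hV hU hUV.symm (by rwa [union_comm]) h
    exact Or.inr fun x hx => (huv hx).resolve_left fun hxu => hUV.le_bot ⟨huU hxu, hsub hx⟩

end Root

end Polynomial

/-- A nonvanishing homotopy starting at a `p`-th power admits a continuous `p`-th root. -/
theorem exists_continuous_pow_eq_of_homotopy {X : Type*} [TopologicalSpace X] {p : ℕ}
    (hp : p ≠ 0) {g : I × X → ℂ} (hg : Continuous g) (hg0 : ∀ y, g y ≠ 0) {h : X → ℂ}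
    (hh : Continuous h) (hgh : ∀ x, h x ^ p = g (0, x)) :
    ∃ G : I × X → ℂ, Continuous G ∧ (∀ y, G y ^ p = g y) ∧ ∀ x, G (0, x) = h x := by
  have hcov := isCoveringMap_npow (𝕜 := ℂ) p (by exact_mod_cast hp)
  have hh0 : ∀ x, h x ≠ 0 := fun x hx => hg0 (0, x) (by rw [← hgh, hx, zero_pow hp])
  let H : C(I × X, {z : ℂ // z ≠ 0}) := ⟨fun y => ⟨g y, hg0 y⟩, by fun_prop⟩
  let f : C(X, {z : ℂ // z ≠ 0}) := ⟨fun x => ⟨h x, hh0 x⟩, by fun_prop⟩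
  have H_0 : ∀ x, H (0, x) = (⟨(f x : ℂ) ^ p, pow_ne_zero p (f x).2⟩ : {z : ℂ // z ≠ 0}) :=
    fun x => Subtype.ext (hgh x).symm
  refine ⟨fun y => hcov.liftHomotopy H f H_0 y,
    continuous_subtype_val.comp (hcov.liftHomotopy H f H_0).continuous, fun y => ?_, fun x => ?_⟩
  · exact congrArg Subtype.val (congrFun (hcov.liftHomotopy_lifts H f H_0) y)
  · exact congrArg Subtype.val (hcov.liftHomotopy_zero H f H_0 x)

/-- The polynomial in `c` whose value is `f_c^[n + 1] 0` for `f_c z = z ^ p + c`. -/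
noncomputable def multibrotPoly (p : ℕ) : ℕ → ℂ[X]
  | 0 => X
  | n + 1 => multibrotPoly p n ^ p + X

namespace multibrotPoly

variable {p : ℕ}

@[simp]
theorem eval_zero (c : ℂ) : (multibrotPoly p 0).eval c = c := by simp [multibrotPoly]

@[simp]
theorem eval_succ (n : ℕ) (c : ℂ) :
    (multibrotPoly p (n + 1)).eval c = (multibrotPoly p n).eval c ^ p + c := by
  simp [multibrotPoly]

theorem iterate_zero_eq_eval (hp : p ≠ 0) (n : ℕ) (c : ℂ) :
    (fun v : ℂ => v ^ p + c)^[n + 1] 0 = (multibrotPoly p n).eval c := by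
  induction n with
  | zero => simp [hp]
  | succ n ih => rw [Function.iterate_succ_apply', ih, eval_succ]

theorem iterate_eval (m k : ℕ) (c : ℂ) :
    (fun v : ℂ => v ^ p + c)^[k] ((multibrotPoly p m).eval c) =
      (multibrotPoly p (m + k)).eval c := by
  induction k with
  | zero => simp
  | succ k ih => rw [Function.iterate_succ_apply', ih, ← add_assoc, eval_succ]

theorem natDegree_eq (hp : 2 ≤ p) (n : ℕ) : (multibrotPoly p n).natDegree = p ^ n := by
  induction n with
  | zero => simp [multibrotPoly]
  | succ n ih =>
    have h : (multibrotPoly p n ^ p).natDegree = p ^ (n + 1) := by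
      rw [natDegree_pow, ih, pow_succ, mul_comm]
    rw [multibrotPoly, natDegree_add_eq_left_of_natDegree_lt, h]
    rw [h, natDegree_X]
    exact Nat.one_lt_pow (by omega) (by omega)

theorem norm_mul_le_norm_pow_add (hp : 2 ≤ p) {z c : ℂ} (hz : 1 ≤ ‖z‖) (hc : ‖c‖ ≤ ‖z‖) :
    ‖z‖ * (‖z‖ - 1) ≤ ‖z ^ p + c‖ := by
  have h1 : ‖z‖ ^ 2 ≤ ‖z‖ ^ p := pow_le_pow_right₀ hz hp
  have h2 : ‖z ^ p‖ - ‖c‖ ≤ ‖z ^ p + c‖ := by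
    simpa using norm_sub_norm_le (z ^ p) (-c)
  rw [norm_pow] at h2
  nlinarith

theorem norm_le_norm_eval (hp : 2 ≤ p) {c : ℂ} {n : ℕ} (h : 2 < ‖(multibrotPoly p n).eval c‖) :
    ‖c‖ ≤ ‖(multibrotPoly p n).eval c‖ := by
  rcases le_or_gt ‖c‖ 2 with hc | hc
  · linarith
  · clear h
    induction n with
    | zero => simp
    | succ n ih =>
      rw [eval_succ]
      have := norm_mul_le_norm_pow_add hp (by linarith) ih
      nlinarith

theorem norm_eval_mul_pow_le (hp : 2 ≤ p) {c : ℂ} {n : ℕ}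
    (h : 2 < ‖(multibrotPoly p n).eval c‖) (k : ℕ) :
    ‖(multibrotPoly p n).eval c‖ * (‖(multibrotPoly p n).eval c‖ - 1) ^ k ≤
      ‖(multibrotPoly p (n + k)).eval c‖ := by
  set r := ‖(multibrotPoly p n).eval c‖
  induction k with
  | zero => simp [r]
  | succ k ih =>
    have hr : r ≤ ‖(multibrotPoly p (n + k)).eval c‖ := by
      have : 1 ≤ (r - 1) ^ k := one_le_pow₀ (by linarith)
      nlinarith
    have hstep := norm_mul_le_norm_pow_add (z := (multibrotPoly p (n + k)).eval c) hp
      (by linarith) (norm_le_norm_eval hp (by linarith))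
    rw [← add_assoc, eval_succ]
    calc r * (r - 1) ^ (k + 1) = r * (r - 1) ^ k * (r - 1) := by ring
      _ ≤ _ := mul_le_mul ih (by linarith) (by linarith) (norm_nonneg _)
      _ ≤ _ := hstep

theorem norm_eval_lt_of_two_lt (hp : 2 ≤ p) {c : ℂ} {j n : ℕ} (hj : j < n)
    (h : 2 < ‖(multibrotPoly p n).eval c‖) :
    ‖(multibrotPoly p j).eval c‖ < ‖(multibrotPoly p n).eval c‖ := by
  rcases le_or_gt ‖(multibrotPoly p j).eval c‖ 2 with h2 | h2
  · linarith
  · obtain ⟨k, rfl⟩ := Nat.exists_eq_add_of_lt hj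
    have hk := norm_eval_mul_pow_le hp h2 (k + 1)
    have : 1 < (‖(multibrotPoly p j).eval c‖ - 1) ^ (k + 1) :=
      one_lt_pow₀ (by linarith) (by omega)
    rw [← add_assoc] at hk
    nlinarith

theorem antitone_setOf_norm_eval_le (hp : 2 ≤ p) :
    Antitone fun n => {c : ℂ | ‖(multibrotPoly p n).eval c‖ ≤ 2} := by
  refine antitone_nat_of_succ_le fun n c hc => ?_
  rw [mem_ofPred_eq] at hc ⊢
  by_contra! h
  have hk := norm_eval_mul_pow_le hp h 1
  rw [pow_one] at hk
  nlinarith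

theorem isBounded_range_iterate_iff (hp : 2 ≤ p) (c : ℂ) :
    Bornology.IsBounded (range fun m : ℕ => (fun v : ℂ => v ^ p + c)^[m] 0) ↔
      ∀ n, ‖(multibrotPoly p n).eval c‖ ≤ 2 := by
  constructor
  · intro hb n
    by_contra! h
    obtain ⟨B, hB⟩ := hb.exists_norm_le
    obtain ⟨k, hk⟩ := pow_unbounded_of_one_lt B
      (show 1 < ‖(multibrotPoly p n).eval c‖ - 1 by linarith)
    have h1 := norm_eval_mul_pow_le hp h k
    have h2 := hB _ (mem_range_self (n + k + 1))
    simp only [iterate_zero_eq_eval (show p ≠ 0 by omega)] at h2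
    have : 0 < (‖(multibrotPoly p n).eval c‖ - 1) ^ k := pow_pos (by linarith) k
    nlinarith
  · intro h
    refine (Metric.isBounded_closedBall (x := (0 : ℂ)) (r := 2)).subset ?_
    rintro _ ⟨m, rfl⟩
    rw [mem_closedBall_zero_iff]
    cases m with
    | zero => simp
    | succ m =>
      simp only [iterate_zero_eq_eval (show p ≠ 0 by omega)]
      exact h m

/-- Where the last of the first `n + 1` critical orbit points has the largest modulus, it admits a
continuous `p ^ n`-th root in the parameter. The root is obtained by deforming `c` to `0`, lifting
the deformation through successive `p`-th roots. -/
theorem exists_continuous_root (hp : p ≠ 0) (n : ℕ) {X : Type*} [TopologicalSpace X]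
    {c : X → ℂ} (hc : Continuous c)
    (h0 : ∀ x, (multibrotPoly p n).eval (c x) ≠ 0)
    (hlt : ∀ x, ∀ j < n,
      ‖(multibrotPoly p j).eval (c x)‖ < ‖(multibrotPoly p n).eval (c x)‖) :
    ∃ q : X → ℂ, Continuous q ∧ ∀ x, q x ^ p ^ n = (multibrotPoly p n).eval (c x) := by
  set O : ℕ → ℂ → ℂ := fun j z => (multibrotPoly p j).eval z with hO
  have hOc : ∀ j, Continuous (O j) := fun j => (multibrotPoly p j).continuous
  let d : I × X → ℂ := fun y => ((1 - (y.1 : ℝ) : ℝ) : ℂ) * c y.2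
  have hd : Continuous d := by fun_prop
  let ρ : I × X → ℝ := fun y =>
    1 + (∑ j ∈ Finset.range n, |‖O j (d y)‖ - ‖O j (c y.2)‖|) / ‖O n (c y.2)‖
  have hpos : ∀ x, 0 < ‖O n (c x)‖ := fun x => norm_pos_iff.2 (h0 x)
  have hρ : Continuous ρ := by
    refine continuous_const.add (Continuous.div ?_ (by fun_prop) fun y => (hpos y.2).ne')
    fun_prop
  have hρpos : ∀ y, 0 < ρ y := fun y => by
    have := hpos y.2
    positivity
  let W : I × X → ℂ := fun y => (ρ y : ℂ) * O n (c y.2)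
  have hW : Continuous W := by fun_prop
  have hWlt : ∀ y, ∀ j < n, ‖O j (d y)‖ < ‖W y‖ := fun y j hj => by
    have hn := hpos y.2
    have hsum : |‖O j (d y)‖ - ‖O j (c y.2)‖| ≤
        ∑ j ∈ Finset.range n, |‖O j (d y)‖ - ‖O j (c y.2)‖| :=
      Finset.single_le_sum (f := fun j => |‖O j (d y)‖ - ‖O j (c y.2)‖|)
        (fun _ _ => abs_nonneg _) (Finset.mem_range.2 hj)
    have hWn : ‖W y‖ = ‖O n (c y.2)‖ +
        ∑ j ∈ Finset.range n, |‖O j (d y)‖ - ‖O j (c y.2)‖| := by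
      rw [norm_mul, Complex.norm_real, Real.norm_of_nonneg (hρpos y).le, add_mul, one_mul,
        div_mul_cancel₀ _ hn.ne']
    have := hlt y.2 j hj
    have := le_abs_self (‖O j (d y)‖ - ‖O j (c y.2)‖)
    simp only [hO] at *
    linarith
  have hd0 : ∀ x, d (0, x) = c x := fun x => by simp [d]
  have hW0 : ∀ x, W (0, x) = O n (c x) := fun x => by simp [W, ρ, hd0]
  have lift : ∀ k ≤ n, ∃ w : I × X → ℂ, Continuous w ∧
      (∀ y, (fun v : ℂ => v ^ p + d y)^[k] (w y) = W y) ∧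
      ∀ x, w (0, x) = O (n - k) (c x) := by
    intro k
    induction k with
    | zero => exact fun _ => ⟨W, hW, fun _ => rfl, hW0⟩
    | succ k ih =>
      intro hk
      obtain ⟨w, hw, hwW, hw0⟩ := ih (by omega)
      have hne : ∀ y, w y - d y ≠ 0 := fun y hy => by
        have h1 := hwW y
        have h2 := iterate_eval (p := p) 0 k (d y)
        rw [sub_eq_zero.1 hy] at h1
        rw [eval_zero, zero_add, h1] at h2
        exact (hWlt y k (by omega)).ne (congrArg norm h2.symm)
      obtain ⟨G, hG, hGp, hG0⟩ := exists_continuous_pow_eq_of_homotopy hp (hw.sub hd) hne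
        ((hOc (n - (k + 1))).comp hc) (fun x => by
          have : n - k = n - (k + 1) + 1 := by omega
          simp only [Pi.sub_apply, Function.comp_apply]
          rw [hw0, hd0, this, hO]
          simp)
      refine ⟨G, hG, fun y => ?_, hG0⟩
      rw [Function.iterate_succ_apply, hGp]
      simpa using hwW y
  obtain ⟨w, hw, hwW, -⟩ := lift n le_rfl
  have hiter : ∀ (k : ℕ) (z : ℂ), (fun v : ℂ => v ^ p + 0)^[k] z = z ^ p ^ k := by
    intro k z
    simp only [add_zero]
    exact congrFun (pow_iterate p k) z
  have hN : p ^ n ≠ 0 := pow_ne_zero n hp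
  refine ⟨fun x => w (1, x) / ((ρ (1, x) ^ ((p ^ n : ℕ) : ℝ)⁻¹ : ℝ) : ℂ), ?_, fun x => ?_⟩
  · refine Continuous.div (by fun_prop) (Complex.continuous_ofReal.comp ?_) fun x => ?_
    · exact (hρ.comp (by fun_prop)).rpow_const fun x => Or.inl (hρpos _).ne'
    · exact_mod_cast (Real.rpow_pos_of_pos (hρpos _) _).ne'
  · have h1 := hwW (1, x)
    have hd1 : d (1, x) = 0 := by simp [d]
    rw [hd1, hiter] at h1
    have hρ0 : (ρ (1, x) : ℂ) ≠ 0 := by exact_mod_cast (hρpos _).ne'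
    rw [div_pow, h1, ← Complex.ofReal_pow, Real.rpow_inv_natCast_pow (hρpos _).le hN,
      mul_div_cancel_left₀ _ hρ0]

theorem isPreconnected_setOf_norm_eval_le (hp : 2 ≤ p) (n : ℕ) :
    IsPreconnected {c : ℂ | ‖(multibrotPoly p n).eval c‖ ≤ 2} := by
  obtain ⟨q, hq, hqP⟩ := exists_continuous_root (p := p) (by omega) n
    (X := {c : ℂ // 2 < ‖(multibrotPoly p n).eval c‖}) continuous_subtype_val
    (fun c => norm_pos_iff.1 (two_pos.trans c.2))
    (fun c j hj => norm_eval_lt_of_two_lt hp hj c.2)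
  refine Polynomial.isPreconnected_setOf_norm_eval_le ?_ zero_le_two hq ?_
  · rw [natDegree_eq hp]
    positivity
  · rwa [natDegree_eq hp]

end multibrotPoly

theorem multibrot_eq_iInter {p : ℕ} (hp : 2 ≤ p) :
    {c : ℂ | Bornology.IsBounded (range fun m : ℕ => (fun v : ℂ => v ^ p + c)^[m] 0)} =
      ⋂ n, {c : ℂ | ‖(multibrotPoly p n).eval c‖ ≤ 2} := by
  ext c
  simpa using multibrotPoly.isBounded_range_iterate_iff hp c

theorem isCompact_setOf_norm_eval_multibrotPoly_le {p : ℕ} (hp : 2 ≤ p) (n : ℕ) :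
    IsCompact {c : ℂ | ‖(multibrotPoly p n).eval c‖ ≤ 2} := by
  refine Polynomial.isCompact_setOf_norm_eval_le ?_ 2
  rw [multibrotPoly.natDegree_eq hp]
  positivity

theorem isCompact_multibrot {p : ℕ} (hp : 2 ≤ p) :
    IsCompact {c : ℂ | Bornology.IsBounded
      (range fun m : ℕ => (fun v : ℂ => v ^ p + c)^[m] 0)} := by
  rw [multibrot_eq_iInter hp]
  exact (isCompact_setOf_norm_eval_multibrotPoly_le hp 0).of_isClosed_subset
    (isClosed_iInter fun n => (isCompact_setOf_norm_eval_multibrotPoly_le hp n).isClosed)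
    (iInter_subset _ 0)

theorem isConnected_multibrot_s16 {p : ℕ} (hp : 2 ≤ p) :
    IsConnected {c : ℂ | Bornology.IsBounded
      (range fun m : ℕ => (fun v : ℂ => v ^ p + c)^[m] 0)} := by
  rw [multibrot_eq_iInter hp]
  refine ⟨⟨0, mem_iInter.2 fun n => ?_⟩, isPreconnected_iInter_of_antitone
    (multibrotPoly.antitone_setOf_norm_eval_le hp)
    (isCompact_setOf_norm_eval_multibrotPoly_le hp)
    (multibrotPoly.isPreconnected_setOf_norm_eval_le hp)⟩
  have h : (multibrotPoly p n).eval 0 = 0 := by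
    induction n with
    | zero => simp
    | succ n ih => simp [ih, show p ≠ 0 by omega]
  simp [h]

theorem Pi.iterate_pow_add_apply {ι : Type*} (p : ℕ) (c v : ι → ℂ) (m : ℕ) (i : ι) :
    (fun v : ι → ℂ => v ^ p + c)^[m] v i = (fun z : ℂ => z ^ p + c i)^[m] (v i) := by
  induction m with
  | zero => rfl
  | succ m ih => simp [Function.iterate_succ_apply', ih]

theorem multibrot_pi_eq {ι : Type*} [Fintype ι] (p : ℕ) :
    {c : ι → ℂ | Bornology.IsBounded
        (range fun m : ℕ => (fun v : ι → ℂ => v ^ p + c)^[m] 0)} =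
      Set.pi univ (fun _ => {c : ℂ | Bornology.IsBounded
        (range fun m : ℕ => (fun v : ℂ => v ^ p + c)^[m] 0)}) := by
  ext c
  simp only [mem_ofPred_eq, mem_univ_pi, ← Bornology.forall_isBounded_image_eval_iff, ← range_comp]
  refine forall_congr' fun i => ?_
  simp [Function.comp_def, Function.eval, Pi.iterate_pow_add_apply]


/-- In the four-fold idempotent representation (tricomplex numbers as the product ring
`Fin 4 → ℂ`), the tricomplex Multibrot set `M_3^p` equals the four-fold Cartesian
product of the complex Multibrot set `M^p`, and it is compact and connected. -/
theorem tricomplex_multibrot_eq_pi_isCompact_isConnected (p : ℕ) (hp : 2 ≤ p) :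
    {c : Fin 4 → ℂ | Bornology.IsBounded
        (Set.range fun m : ℕ => (fun v : Fin 4 → ℂ => v ^ p + c)^[m] 0)} =
      Set.pi Set.univ (fun _ => {c : ℂ | Bornology.IsBounded
        (Set.range fun m : ℕ => (fun v : ℂ => v ^ p + c)^[m] 0)}) ∧
    IsCompact {c : Fin 4 → ℂ | Bornology.IsBounded
        (Set.range fun m : ℕ => (fun v : Fin 4 → ℂ => v ^ p + c)^[m] 0)} ∧
    IsConnected {c : Fin 4 → ℂ | Bornology.IsBounded
        (Set.range fun m : ℕ => (fun v : Fin 4 → ℂ => v ^ p + c)^[m] 0)} := by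
  rw [multibrot_pi_eq]
  exact ⟨rfl, isCompact_univ_pi fun _ => isCompact_multibrot hp,
    isConnected_univ_pi.2 fun _ => isConnected_multibrot_s16 hp⟩
end
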